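/- arXiv:1806.04129 — 11 statements merged into one kernel-verified Lean document; each statement's English description precedes it below -/
import Mathlib

section
/- For every s with 0 < s < 1, the functions Δ_s⁻ and Δ_s⁺ are strictly increasing on ℝ: for all real x < y, Δ_s⁻(x) < Δ_s⁻(y) and Δ_s⁺(x) < Δ_s⁺(y). -/
open scoped BigOperators

/-- `Δ_s⁻(x) = ((1−s)/s)² · ∑_{j=1}^∞ s^j ⌈jx⌉`. -/
noncomputable def DeltaMinus (s x : ℝ) : ℝ :=
  ((1 - s) / s) ^ 2 * ∑' j : ℕ, s ^ (j + 1) * ((⌈((j : ℝ) + 1) * x⌉ : ℤ) : ℝ)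

/-- `Δ_s⁺(x) = (1−s)/s + ((1−s)/s)² · ∑_{j=1}^∞ s^j ⌊jx⌋`. -/
noncomputable def DeltaPlus (s x : ℝ) : ℝ :=
  (1 - s) / s + ((1 - s) / s) ^ 2 * ∑' j : ℕ, s ^ (j + 1) * ((⌊((j : ℝ) + 1) * x⌋ : ℤ) : ℝ)

theorem summable_pow_mul_floor {s : ℝ} (hs0 : 0 < s) (hs1 : s < 1) (x : ℝ) :
    Summable fun j : ℕ => s ^ (j + 1) * ((⌊((j : ℝ) + 1) * x⌋ : ℤ) : ℝ) := by
  have hlin : Summable fun j : ℕ => (j : ℝ) * s ^ j := by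
    simpa using summable_pow_mul_geometric_of_norm_lt_one (R := ℝ) 1
      (by rwa [Real.norm_of_nonneg hs0.le])
  have hgeom : Summable fun j : ℕ => s ^ j := summable_geometric_of_lt_one hs0.le hs1
  refine .of_norm_bounded (g := fun j : ℕ => s * |x| * (j * s ^ j) + s * (|x| + 1) * s ^ j)
    ((hlin.mul_left _).add (hgeom.mul_left _)) fun j => ?_
  have hfloor : |((⌊((j : ℝ) + 1) * x⌋ : ℤ) : ℝ)| ≤ ((j : ℝ) + 1) * |x| + 1 := by
    have habs : |((j : ℝ) + 1) * x| = ((j : ℝ) + 1) * |x| := by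
      rw [abs_mul, abs_of_nonneg (by positivity)]
    rw [← habs, abs_le]
    constructor <;>
      linarith [Int.floor_le (((j : ℝ) + 1) * x), Int.lt_floor_add_one (((j : ℝ) + 1) * x),
        neg_abs_le (((j : ℝ) + 1) * x), le_abs_self (((j : ℝ) + 1) * x)]
  rw [norm_mul, Real.norm_of_nonneg (by positivity), Real.norm_eq_abs]
  calc s ^ (j + 1) * |((⌊((j : ℝ) + 1) * x⌋ : ℤ) : ℝ)|
      ≤ s ^ (j + 1) * (((j : ℝ) + 1) * |x| + 1) := by gcongr
    _ = s * |x| * (j * s ^ j) + s * (|x| + 1) * s ^ j := by ring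

theorem strictMono_tsum_pow_mul_floor {s : ℝ} (hs0 : 0 < s) (hs1 : s < 1) :
    StrictMono fun x : ℝ => ∑' j : ℕ, s ^ (j + 1) * ((⌊((j : ℝ) + 1) * x⌋ : ℤ) : ℝ) := by
  intro x y hxy
  obtain ⟨n, hn⟩ := exists_nat_gt (1 / (y - x))
  have hgap : 1 < (n : ℝ) * (y - x) := (div_lt_iff₀ (sub_pos.2 hxy)).1 hn
  refine Summable.tsum_lt_tsum (i := n) (fun j => ?_) ?_
    (summable_pow_mul_floor hs0 hs1 x) (summable_pow_mul_floor hs0 hs1 y)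
  · dsimp only
    gcongr
  · refine mul_lt_mul_of_pos_left (Int.cast_lt.2 ?_) (by positivity)
    rw [← Int.add_one_le_iff, Int.le_floor]
    push_cast
    linarith [Int.floor_le (((n : ℝ) + 1) * x)]

theorem DeltaMinus_eq_neg_tsum_floor (s x : ℝ) :
    DeltaMinus s x = -(((1 - s) / s) ^ 2 *
      ∑' j : ℕ, s ^ (j + 1) * ((⌊((j : ℝ) + 1) * -x⌋ : ℤ) : ℝ)) := by
  simp [DeltaMinus, mul_neg, Int.floor_neg, tsum_neg]

theorem stmt_0 (s : ℝ) (hs0 : 0 < s) (hs1 : s < 1) :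
    StrictMono (DeltaMinus s) ∧ StrictMono (DeltaPlus s) := by
  have hc : 0 < ((1 - s) / s) ^ 2 := pow_pos (div_pos (sub_pos.2 hs1) hs0) 2
  have hmono := strictMono_tsum_pow_mul_floor hs0 hs1
  constructor
  · intro x y hxy
    rw [DeltaMinus_eq_neg_tsum_floor, DeltaMinus_eq_neg_tsum_floor]
    exact neg_lt_neg (mul_lt_mul_of_pos_left (hmono (neg_lt_neg hxy)) hc)
  · intro x y hxy
    exact add_lt_add_right (mul_lt_mul_of_pos_left (hmono hxy) hc) _
end

section
/- For every s with 0 < s < 1 and every irrational real number x > 0, Δ_s⁻(x) = Δ_s⁺(x) = ((1−s)/s) · ∑_{ℓ=0}^∞ s^{⌊ℓ/x⌋}. -/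
open scoped BigOperators

theorem hasSum_natCast_lt_indicator (c : ℝ) {y : ℝ} :
    HasSum (fun l : ℕ => if (l : ℝ) < y then c else 0) (c * (⌈y⌉₊ : ℝ)) := by
  have h : HasSum (fun l : ℕ => if (l : ℝ) < y then c else 0)
      (∑ l ∈ Finset.range ⌈y⌉₊, if (l : ℝ) < y then c else 0) := by
    apply hasSum_sum_of_ne_finset_zero
    intro l hl
    rw [Finset.mem_range, Nat.lt_ceil] at hl
    exact if_neg hl
  have h' : (∑ l ∈ Finset.range ⌈y⌉₊, if (l : ℝ) < y then c else 0) = c * (⌈y⌉₊ : ℝ) := by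
    rw [Finset.sum_congr rfl fun l hl => if_pos (Nat.lt_ceil.1 (Finset.mem_range.1 hl))]
    simp [mul_comm]
  rwa [h'] at h

theorem hasSum_geometric_tail {s : ℝ} (hs0 : 0 < s) (hs1 : s < 1) (m : ℕ) :
    HasSum (fun j : ℕ => if m ≤ j then s ^ (j + 1) else 0) (s ^ m * (s / (1 - s))) := by
  have h := (hasSum_geometric_of_lt_one hs0.le hs1).mul_left (s ^ (m + 1))
  have h0 : ∑ j ∈ Finset.range m, (if m ≤ j then s ^ (j + 1) else 0) = 0 :=
    Finset.sum_eq_zero fun j hj => if_neg (by simpa using hj)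
  have key := (hasSum_nat_add_iff (f := fun j : ℕ => if m ≤ j then s ^ (j + 1) else 0)
    (g := s ^ m * (s / (1 - s))) m).1
  rw [h0, add_zero] at key
  have hval : s ^ m * (s / (1 - s)) = s ^ (m + 1) * (1 - s)⁻¹ := by
    rw [pow_succ, mul_assoc, div_eq_mul_inv]
  rw [hval] at key ⊢
  have hshift : (fun n => if m ≤ n + m then s ^ (n + m + 1) else 0) =
      fun n => s ^ (m + 1) * s ^ n := by
    funext n
    rw [if_pos (Nat.le_add_left m n)]
    ring
  exact key (hshift ▸ h)

theorem summable_pow_succ_mul_ceil {s : ℝ} (hs0 : 0 < s) (hs1 : s < 1) {x : ℝ} (hx : 0 < x) :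
    Summable fun j : ℕ => s ^ (j + 1) * (⌈((j : ℝ) + 1) * x⌉₊ : ℝ) := by
  have hgeom := summable_geometric_of_lt_one hs0.le hs1
  have hlin : Summable fun j : ℕ => (j : ℝ) * s ^ j := by
    simpa using summable_pow_mul_geometric_of_norm_lt_one 1
      (show ‖s‖ < 1 by rwa [Real.norm_of_nonneg hs0.le])
  refine Summable.of_nonneg_of_le (fun j => by positivity) (fun j => ?_)
    ((hlin.mul_left (s * x)).add (hgeom.mul_left (s * (x + 1))))
  have h := (Nat.ceil_lt_add_one (show 0 ≤ ((j : ℝ) + 1) * x by positivity)).le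
  calc s ^ (j + 1) * (⌈((j : ℝ) + 1) * x⌉₊ : ℝ)
      ≤ s ^ (j + 1) * (((j : ℝ) + 1) * x + 1) := by gcongr
    _ = s * x * ((j : ℝ) * s ^ j) + s * (x + 1) * s ^ j := by ring

/-- Both sides count the pairs `(j, l)` with `l < (j + 1) * x`, weighted by `s ^ (j + 1)`. -/
theorem tsum_pow_succ_mul_ceil {s : ℝ} (hs0 : 0 < s) (hs1 : s < 1) {x : ℝ} (hx : 0 < x) :
    ∑' j : ℕ, s ^ (j + 1) * (⌈((j : ℝ) + 1) * x⌉₊ : ℝ) =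
      s / (1 - s) * ∑' l : ℕ, s ^ ⌊(l : ℝ) / x⌋₊ := by
  let f : ℕ → ℕ → ℝ := fun j l => if (l : ℝ) < ((j : ℝ) + 1) * x then s ^ (j + 1) else 0
  have hrow : ∀ j, HasSum (f j) (s ^ (j + 1) * (⌈((j : ℝ) + 1) * x⌉₊ : ℝ)) := fun j =>
    hasSum_natCast_lt_indicator (s ^ (j + 1))
  have hcol : ∀ l, HasSum (fun j => f j l) (s ^ ⌊(l : ℝ) / x⌋₊ * (s / (1 - s))) := by
    intro l
    convert hasSum_geometric_tail hs0 hs1 ⌊(l : ℝ) / x⌋₊ using 2 with j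
    have hiff : (l : ℝ) < ((j : ℝ) + 1) * x ↔ ⌊(l : ℝ) / x⌋₊ ≤ j := by
      rw [← Nat.lt_succ_iff, Nat.floor_lt (by positivity), div_lt_iff₀ hx, Nat.cast_succ]
    simp only [f, hiff]
  have hf : Summable (Function.uncurry f) := by
    refine (summable_prod_of_nonneg ?_).2 ⟨fun j => (hrow j).summable, ?_⟩
    · rintro ⟨j, l⟩
      simp only [f, Function.uncurry, Pi.zero_apply]
      split_ifs <;> positivity
    · exact (summable_pow_succ_mul_ceil hs0 hs1 hx).congr fun j => (hrow j).tsum_eq.symm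
  have hcomm := hf.tsum_comm
  simp only [(hrow _).tsum_eq, (hcol _).tsum_eq, tsum_mul_right] at hcomm
  rw [← mul_comm]
  exact hcomm.symm

theorem deltaMinus_eq {s : ℝ} (hs0 : 0 < s) (hs1 : s < 1) {x : ℝ} (hx : 0 < x) :
    DeltaMinus s x = (1 - s) / s * ∑' l : ℕ, s ^ (⌊(l : ℝ) / x⌋ : ℤ) := by
  have hs : 1 - s ≠ 0 := (sub_pos.2 hs1).ne'
  have hceil : ∀ j : ℕ, ((⌈((j : ℝ) + 1) * x⌉ : ℤ) : ℝ) = (⌈((j : ℝ) + 1) * x⌉₊ : ℝ) :=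
    fun j => (natCast_ceil_eq_intCast_ceil (by positivity)).symm
  have hfloor : ∀ l : ℕ, s ^ (⌊(l : ℝ) / x⌋ : ℤ) = s ^ ⌊(l : ℝ) / x⌋₊ := fun l => by
    rw [← zpow_natCast, Int.natCast_floor_eq_floor (by positivity)]
  simp only [DeltaMinus, hceil, hfloor]
  rw [tsum_pow_succ_mul_ceil hs0 hs1 hx]
  field_simp

theorem deltaPlus_eq_deltaMinus {s : ℝ} (hs0 : 0 < s) (hs1 : s < 1) {x : ℝ} (hx : Irrational x)
    (hxpos : 0 < x) : DeltaPlus s x = DeltaMinus s x := by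
  have hs : 1 - s ≠ 0 := (sub_pos.2 hs1).ne'
  have hceil : ∀ j : ℕ, ((⌈((j : ℝ) + 1) * x⌉ : ℤ) : ℝ) = (⌈((j : ℝ) + 1) * x⌉₊ : ℝ) :=
    fun j => (natCast_ceil_eq_intCast_ceil (by positivity)).symm
  have hfloor : ∀ j : ℕ, ((⌊((j : ℝ) + 1) * x⌋ : ℤ) : ℝ) = (⌈((j : ℝ) + 1) * x⌉₊ : ℝ) - 1 := by
    intro j
    have hirr : Irrational (((j : ℝ) + 1) * x) := by
      exact_mod_cast hx.natCast_mul (Nat.succ_ne_zero j)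
    have h : ⌈((j : ℝ) + 1) * x⌉ = ⌊((j : ℝ) + 1) * x⌋ + 1 := by
      rw [Int.ceil_eq_iff]
      push_cast
      refine ⟨?_, (Int.lt_floor_add_one _).le⟩
      rw [add_sub_cancel_right]
      exact lt_of_le_of_ne (Int.floor_le _) (hirr.ne_int _).symm
    rw [← hceil, h]
    push_cast
    ring
  have hgeom := (hasSum_geometric_of_lt_one hs0.le hs1).mul_left s
  simp only [← pow_succ'] at hgeom
  simp only [DeltaPlus, DeltaMinus, hceil, hfloor, mul_sub, mul_one]
  rw [(summable_pow_succ_mul_ceil hs0 hs1 hxpos).tsum_sub hgeom.summable, hgeom.tsum_eq]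
  generalize ∑' j : ℕ, s ^ (j + 1) * (⌈((j : ℝ) + 1) * x⌉₊ : ℝ) = S
  field_simp
  ring

theorem stmt_4 (s : ℝ) (hs0 : 0 < s) (hs1 : s < 1) (x : ℝ) (hx : Irrational x)
    (hxpos : 0 < x) :
    DeltaMinus s x = (1 - s) / s * ∑' ℓ : ℕ, s ^ (⌊(ℓ : ℝ) / x⌋ : ℤ) ∧
    DeltaPlus s x = (1 - s) / s * ∑' ℓ : ℕ, s ^ (⌊(ℓ : ℝ) / x⌋ : ℤ) := by
  have h := deltaMinus_eq hs0 hs1 hxpos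
  exact ⟨h, (deltaPlus_eq_deltaMinus hs0 hs1 hx hxpos).trans h⟩
end

section
/- Let 0 < s < 1 and let k, n be integers with n > 0 and gcd(k,n) = 1. Then Δ_s⁻(k/n) = k·s^{n−2}(1−s)/(1−s^n) + ((1−s)²/(1−s^n)) · ∑_{r=1}^{n−1} s^{r−2} ⌈rk/n⌉, and Δ_s⁺(k/n) = k·s^{n−2}(1−s)/(1−s^n) + ((1−s)²/(1−s^n)) · ∑_{r=1}^{n−1} s^{r−2} ⌊rk/n⌋ + (1−s)/s. -/
open scoped BigOperators

theorem Finset.sum_Icc_one_natCast {M : Type*} [AddCommMonoid M] (g : ℤ → M) (m : ℕ) :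
    ∑ r ∈ Finset.Icc (1 : ℤ) m, g r = ∑ j ∈ Finset.range m, g (j + 1) := by
  symm
  refine Finset.sum_nbij' (fun j : ℕ => (j : ℤ) + 1) (fun r => (r - 1).toNat) ?_ ?_ ?_ ?_
    fun _ _ => rfl
  all_goals
    intro a ha
    simp only [Finset.mem_range, Finset.mem_Icc] at ha ⊢
    omega

theorem summable_pow_mul_of_abs_le_linear {s : ℝ} (hs0 : 0 < s) (hs1 : s < 1) {f : ℕ → ℝ} {C : ℝ}
    (hf : ∀ j, |f j| ≤ j * C + 1) : Summable fun j => s ^ j * f j := by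
  have hs : ‖s‖ < 1 := by rwa [Real.norm_of_nonneg hs0.le]
  have h1 := (summable_pow_mul_geometric_of_norm_lt_one 1 hs).mul_right C
  refine Summable.of_norm_bounded (h1.add (summable_geometric_of_lt_one hs0.le hs1)) fun j => ?_
  rw [norm_mul, norm_pow, Real.norm_of_nonneg hs0.le, Real.norm_eq_abs]
  calc s ^ j * |f j| ≤ s ^ j * (j * C + 1) := by gcongr; exact hf j
    _ = _ := by ring

/-- The generating function of a sequence that grows by `k` over each period `m + 1`. -/
theorem tsum_pow_mul_of_quasiperiodic {s : ℝ} (hs0 : 0 < s) (hs1 : s < 1) {f : ℤ → ℝ} {C k : ℝ}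
    (m : ℕ) (hf0 : f 0 = 0) (hf : ∀ j : ℕ, |f j| ≤ j * C + 1)
    (hper : ∀ j, f (j + (m + 1)) = f j + k) :
    ((1 - s) / s) ^ 2 * ∑' j : ℕ, s ^ (j + 1) * f (j + 1) =
      k * s ^ ((m + 1 : ℤ) - 2) * (1 - s) / (1 - s ^ (m + 1 : ℤ)) +
        (1 - s) ^ 2 / (1 - s ^ (m + 1 : ℤ)) *
          ∑ r ∈ Finset.Icc (1 : ℤ) m, s ^ (r - 2) * f r := by
  have hsum : Summable fun j : ℕ => s ^ j * f j :=
    summable_pow_mul_of_abs_le_linear hs0 hs1 hf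
  have hshift : ∑' j : ℕ, s ^ j * f j = ∑' j : ℕ, s ^ (j + 1) * f (j + 1) := by
    rw [hsum.tsum_eq_zero_add]
    simp [hf0]
  have hsplit := hsum.sum_add_tsum_nat_add (m + 1)
  have htail : ∑' j : ℕ, s ^ (j + (m + 1)) * f ((j + (m + 1) : ℕ) : ℤ) =
      s ^ (m + 1) * ∑' j : ℕ, s ^ j * f j + s ^ (m + 1) * k * (1 - s)⁻¹ := by
    rw [← tsum_geometric_of_lt_one hs0.le hs1, ← tsum_mul_left, ← tsum_mul_left,
      ← (hsum.mul_left _).tsum_add ((summable_geometric_of_lt_one hs0.le hs1).mul_left _)]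
    refine tsum_congr fun j => ?_
    push_cast
    rw [hper]
    ring
  have hfin : ∑ r ∈ Finset.Icc (1 : ℤ) m, s ^ (r - 2) * f r =
      (s ^ 2)⁻¹ * ∑ j ∈ Finset.range (m + 1), s ^ j * f j := by
    rw [Finset.sum_Icc_one_natCast, Finset.sum_range_succ', Nat.cast_zero, hf0, mul_zero, add_zero,
      Finset.mul_sum]
    refine Finset.sum_congr rfl fun j _ => ?_
    rw [zpow_sub₀ hs0.ne', ← Nat.cast_succ, zpow_natCast]
    norm_cast
    field_simp
  rw [htail, hshift] at hsplit
  rw [hfin]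
  have hpow : s ^ ((m + 1 : ℤ) - 2) = s ^ (m + 1) / s ^ 2 := by
    rw [zpow_sub₀ hs0.ne']
    norm_cast
  have hpow' : s ^ (m + 1 : ℤ) = s ^ (m + 1) := by norm_cast
  rw [hpow, hpow']
  have hne : 1 - s ^ (m + 1) ≠ 0 := (sub_pos.2 (pow_lt_one₀ hs0.le hs1 m.succ_ne_zero)).ne'
  have hne' : 1 - s ≠ 0 := (sub_pos.2 hs1).ne'
  generalize ∑' j : ℕ, s ^ (j + 1) * f (j + 1) = S at *
  generalize ∑ j ∈ Finset.range (m + 1), s ^ j * f j = P at *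
  have hP : P = S - (s ^ (m + 1) * S + s ^ (m + 1) * k * (1 - s)⁻¹) := by linarith
  rw [hP]
  generalize s ^ (m + 1) = q at *
  field_simp
  ring

theorem stmt_5 (s : ℝ) (hs0 : 0 < s) (hs1 : s < 1) (k n : ℤ) (hn : 0 < n)
    (hgcd : Int.gcd k n = 1) :
    DeltaMinus s ((k : ℝ) / (n : ℝ)) =
      (k : ℝ) * s ^ (n - 2) * (1 - s) / (1 - s ^ n) +
        (1 - s) ^ 2 / (1 - s ^ n) *
          ∑ r ∈ Finset.Icc 1 (n - 1), s ^ (r - 2) * ((⌈(r : ℝ) * k / n⌉ : ℤ) : ℝ) ∧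
    DeltaPlus s ((k : ℝ) / (n : ℝ)) =
      (k : ℝ) * s ^ (n - 2) * (1 - s) / (1 - s ^ n) +
        (1 - s) ^ 2 / (1 - s ^ n) *
          ∑ r ∈ Finset.Icc 1 (n - 1), s ^ (r - 2) * ((⌊(r : ℝ) * k / n⌋ : ℤ) : ℝ) +
        (1 - s) / s := by
  obtain ⟨m, rfl⟩ : ∃ m : ℕ, n = m + 1 := ⟨(n - 1).toNat, by omega⟩
  have hm : ((m : ℝ) + 1) ≠ 0 := by positivity
  have hperiod (j : ℤ) : ((j + (m + 1) : ℤ) : ℝ) * k / ((m + 1 : ℤ) : ℝ) =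
      (j : ℝ) * k / ((m + 1 : ℤ) : ℝ) + k := by
    push_cast
    field_simp
  have habs (j : ℕ) : |((j : ℤ) : ℝ) * k / ((m + 1 : ℤ) : ℝ)| =
      j * |(k : ℝ) / ((m + 1 : ℤ) : ℝ)| := by
    rw [mul_div_assoc, abs_mul, Int.cast_natCast, Nat.abs_cast]
  have hceil := tsum_pow_mul_of_quasiperiodic hs0 hs1 (k := k)
    (f := fun j => ((⌈(j : ℝ) * k / ((m + 1 : ℤ) : ℝ)⌉ : ℤ) : ℝ)) m (by simp)
    (fun j => by
      rw [← habs]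
      generalize ((j : ℤ) : ℝ) * k / ((m + 1 : ℤ) : ℝ) = y
      have h1 := Int.le_ceil y
      have h2 := Int.ceil_lt_add_one y
      rw [abs_le]
      constructor <;> linarith [neg_abs_le y, le_abs_self y])
    (fun j => by rw [hperiod, Int.ceil_add_intCast]; push_cast; rfl)
  have hfloor := tsum_pow_mul_of_quasiperiodic hs0 hs1 (k := k)
    (f := fun j => ((⌊(j : ℝ) * k / ((m + 1 : ℤ) : ℝ)⌋ : ℤ) : ℝ)) m (by simp)
    (fun j => by
      rw [← habs]
      generalize ((j : ℤ) : ℝ) * k / ((m + 1 : ℤ) : ℝ) = y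
      have h1 := Int.floor_le y
      have h2 := Int.lt_floor_add_one y
      rw [abs_le]
      constructor <;> linarith [neg_abs_le y, le_abs_self y])
    (fun j => by rw [hperiod, Int.floor_add_intCast]; push_cast; rfl)
  have hcast (j : ℕ) : (((j : ℤ) + 1 : ℤ) : ℝ) = (j : ℝ) + 1 := by push_cast; rfl
  simp only [hcast, mul_div_assoc ((_ : ℕ) + 1 : ℝ)] at hceil hfloor
  rw [add_sub_cancel_right, DeltaMinus, DeltaPlus, add_comm ((1 - s) / s)]
  simp only [hcast]
  exact ⟨hceil, by rw [hfloor]⟩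
end

section
/- For every s with 0 < s < 1, the set of points of ℝ at which Δ_s⁻ is discontinuous is exactly ℚ, and the set of points at which Δ_s⁺ is discontinuous is exactly ℚ. -/
open scoped BigOperators

open Filter Topology

/-- The power series `∑_{j=1}^∞ s^j ⌊jx⌋`. -/
noncomputable def floorSeries (s x : ℝ) : ℝ :=
  ∑' j : ℕ, s ^ (j + 1) * ((⌊((j : ℝ) + 1) * x⌋ : ℤ) : ℝ)

lemma DeltaMinus_eq (s x : ℝ) :
    DeltaMinus s x = -(((1 - s) / s) ^ 2 * floorSeries s (-x)) := by
  simp only [DeltaMinus, floorSeries, mul_neg, Int.floor_neg, Int.cast_neg, tsum_neg, neg_neg]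

lemma DeltaPlus_eq (s x : ℝ) :
    DeltaPlus s x = (1 - s) / s + ((1 - s) / s) ^ 2 * floorSeries s x := rfl

lemma abs_floor_le (x : ℝ) : |((⌊x⌋ : ℤ) : ℝ)| ≤ |x| + 1 := by
  have h₁ := Int.floor_le x
  have h₂ := Int.lt_floor_add_one x
  rw [abs_le]
  constructor <;> linarith [neg_abs_le x, le_abs_self x]

lemma norm_floorSeries_term_le {s x B : ℝ} (hs : 0 ≤ s) (hx : |x| ≤ B) (j : ℕ) :
    ‖s ^ (j + 1) * ((⌊((j : ℝ) + 1) * x⌋ : ℤ) : ℝ)‖ ≤ s ^ (j + 1) * (((j : ℝ) + 1) * B + 1) := by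
  rw [norm_mul, Real.norm_of_nonneg (by positivity), Real.norm_eq_abs]
  gcongr
  refine (abs_floor_le _).trans ?_
  rw [abs_mul, abs_of_nonneg (by positivity : (0 : ℝ) ≤ (j : ℝ) + 1)]
  gcongr

lemma summable_pow_mul_linear {s : ℝ} (hs0 : 0 ≤ s) (hs1 : s < 1) (B : ℝ) :
    Summable fun j : ℕ => s ^ (j + 1) * (((j : ℝ) + 1) * B + 1) := by
  have hs : ‖s‖ < 1 := by rwa [Real.norm_of_nonneg hs0]
  have h₁ := (summable_pow_mul_geometric_of_norm_lt_one 1 hs).mul_left (s * B)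
  have h₀ := (summable_geometric_of_lt_one hs0 hs1).mul_left (s * (B + 1))
  refine (h₁.add h₀).congr fun j => ?_
  ring

lemma summable_floorSeries {s : ℝ} (hs0 : 0 ≤ s) (hs1 : s < 1) (x : ℝ) :
    Summable fun j : ℕ => s ^ (j + 1) * ((⌊((j : ℝ) + 1) * x⌋ : ℤ) : ℝ) :=
  .of_norm_bounded (summable_pow_mul_linear hs0 hs1 |x|)
    (norm_floorSeries_term_le hs0 le_rfl)

lemma continuousAt_cast_floor {x : ℝ} (hx : ∀ n : ℤ, (n : ℝ) ≠ x) :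
    ContinuousAt (fun y : ℝ => ((⌊y⌋ : ℤ) : ℝ)) x := by
  have h : ∀ᶠ y in 𝓝 x, ((⌊y⌋ : ℤ) : ℝ) = ((⌊x⌋ : ℤ) : ℝ) := by
    filter_upwards [Ioo_mem_nhds ((Int.floor_le x).lt_of_ne (hx _)) (Int.lt_floor_add_one x)]
      with y hy
    rw [Int.floor_eq_iff.2 ⟨hy.1.le, hy.2⟩]
  exact continuousAt_const.congr (h.mono fun _ => Eq.symm)

lemma continuousAt_floorSeries {s x : ℝ} (hs0 : 0 ≤ s) (hs1 : s < 1) (hx : Irrational x) :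
    ContinuousAt (floorSeries s) x := by
  refine tendsto_tsum_of_dominated_convergence
    (summable_pow_mul_linear hs0 hs1 (|x| + 1)) (fun j => ?_) ?_
  · have hj : Irrational (((j : ℝ) + 1) * x) := by
      exact_mod_cast hx.natCast_mul (Nat.succ_ne_zero j)
    have h := continuousAt_cast_floor fun n => (hj.ne_int n).symm
    exact (h.comp (f := fun y : ℝ => ((j : ℝ) + 1) * y) (by fun_prop)).const_mul _
  · have h : ∀ᶠ y in 𝓝 x, |y| < |x| + 1 :=
      continuous_abs.continuousAt.eventually_lt continuousAt_const (lt_add_one _)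
    filter_upwards [h] with y hy j using norm_floorSeries_term_le hs0 hy.le j

lemma floorSeries_add_pow_le {s y : ℝ} (hs0 : 0 ≤ s) (hs1 : s < 1) (r : ℚ) (hy : y < r) :
    floorSeries s y + s ^ r.den ≤ floorSeries s r := by
  obtain ⟨k, hk⟩ : ∃ k, r.den = k + 1 := Nat.exists_eq_succ_of_ne_zero r.den_nz
  have hsum := (summable_floorSeries hs0 hs1 r).sub (summable_floorSeries hs0 hs1 y)
  have hnum : ((k : ℝ) + 1) * (r : ℝ) = (r.num : ℝ) := by
    have := Rat.den_mul_eq_num r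
    rw [hk] at this
    exact_mod_cast this
  have hjump : ((⌊((k : ℝ) + 1) * y⌋ : ℤ) : ℝ) + 1 ≤ ((⌊((k : ℝ) + 1) * (r : ℝ)⌋ : ℤ) : ℝ) := by
    rw [hnum, Int.floor_intCast]
    have : ⌊((k : ℝ) + 1) * y⌋ < r.num := by
      rw [Int.floor_lt, ← hnum]
      gcongr
    exact_mod_cast this
  have hterm := hsum.le_tsum k fun j _ => by
    rw [← mul_sub]
    have : ⌊((j : ℝ) + 1) * y⌋ ≤ ⌊((j : ℝ) + 1) * (r : ℝ)⌋ := by gcongr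
    exact mul_nonneg (by positivity) (sub_nonneg.2 (by exact_mod_cast this))
  rw [(summable_floorSeries hs0 hs1 r).tsum_sub (summable_floorSeries hs0 hs1 y)] at hterm
  change _ ≤ floorSeries s r - floorSeries s y at hterm
  rw [hk]
  have := mul_le_mul_of_nonneg_left hjump (pow_nonneg hs0 (k + 1))
  linarith

lemma not_continuousAt_floorSeries {s : ℝ} (hs0 : 0 < s) (hs1 : s < 1) (r : ℚ) :
    ¬ ContinuousAt (floorSeries s) r := by
  intro h
  have hle : floorSeries s r ≤ floorSeries s r - s ^ r.den := by
    refine le_of_tendsto (h.tendsto.mono_left (nhdsWithin_le_nhds (s := Set.Iio (r : ℝ)))) ?_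
    filter_upwards [self_mem_nhdsWithin] with y hy
    exact le_sub_iff_add_le.2 (floorSeries_add_pow_le hs0.le hs1 r hy)
  linarith [pow_pos hs0 r.den]

lemma not_continuousAt_floorSeries_iff {s : ℝ} (hs0 : 0 < s) (hs1 : s < 1) (x : ℝ) :
    ¬ ContinuousAt (floorSeries s) x ↔ x ∈ Set.range ((↑) : ℚ → ℝ) := by
  constructor
  · exact fun h => by_contra fun hx => h (continuousAt_floorSeries hs0.le hs1 hx)
  · rintro ⟨r, rfl⟩
    exact not_continuousAt_floorSeries hs0 hs1 r

lemma continuousAt_DeltaPlus_iff {s : ℝ} (hs0 : 0 < s) (hs1 : s < 1) (x : ℝ) :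
    ContinuousAt (DeltaPlus s) x ↔ ContinuousAt (floorSeries s) x := by
  have hc : ((1 - s) / s) ^ 2 ≠ 0 := (pow_pos (div_pos (sub_pos.2 hs1) hs0) 2).ne'
  constructor
  · intro h
    have h' : ContinuousAt (fun y => DeltaPlus s y - (1 - s) / s) x := h.sub_const _
    refine (h'.const_mul (((1 - s) / s) ^ 2)⁻¹).congr (.of_forall fun y => ?_)
    simp only [DeltaPlus_eq, add_sub_cancel_left, inv_mul_cancel_left₀ hc]
  · exact fun h => (h.const_mul _).const_add _

lemma continuousAt_DeltaMinus_iff {s : ℝ} (hs0 : 0 < s) (hs1 : s < 1) (x : ℝ) :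
    ContinuousAt (DeltaMinus s) x ↔ ContinuousAt (floorSeries s) (-x) := by
  have hc : ((1 - s) / s) ^ 2 ≠ 0 := (pow_pos (div_pos (sub_pos.2 hs1) hs0) 2).ne'
  constructor
  · intro h
    have h' : ContinuousAt (fun y => DeltaMinus s (-y)) (-x) :=
      ContinuousAt.comp (g := DeltaMinus s) (by rwa [neg_neg]) continuousAt_neg
    refine (h'.neg.const_mul (((1 - s) / s) ^ 2)⁻¹).congr (.of_forall fun y => ?_)
    simp only [DeltaMinus_eq, Pi.neg_apply, neg_neg, inv_mul_cancel_left₀ hc]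
  · intro h
    have h' : ContinuousAt (fun y => floorSeries s (-y)) x := h.comp continuousAt_neg
    exact (h'.const_mul _).neg.congr (.of_forall fun y => (DeltaMinus_eq s y).symm)

theorem stmt_8 (s : ℝ) (hs0 : 0 < s) (hs1 : s < 1) :
    {x : ℝ | ¬ ContinuousAt (DeltaMinus s) x} = Set.range ((↑) : ℚ → ℝ) ∧
    {x : ℝ | ¬ ContinuousAt (DeltaPlus s) x} = Set.range ((↑) : ℚ → ℝ) := by
  constructor <;> ext x
  · rw [Set.mem_ofPred_eq, continuousAt_DeltaMinus_iff hs0 hs1,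
      not_continuousAt_floorSeries_iff hs0 hs1]
    exact not_iff_not.1 irrational_neg_iff
  · rw [Set.mem_ofPred_eq, continuousAt_DeltaPlus_iff hs0 hs1,
      not_continuousAt_floorSeries_iff hs0 hs1]
end

section
/- For every x ∈ ℝ, lim_{s→1⁻} Δ_s⁻(x) = x and lim_{s→1⁻} Δ_s⁺(x) = x, where the limit is taken as s tends to 1 from below within (0,1). -/
open scoped BigOperators

theorem hasSum_pow_succ_mul_succ {s : ℝ} (hs : s ∈ Set.Ioo (0 : ℝ) 1) :
    HasSum (fun j : ℕ => s ^ (j + 1) * ((j : ℝ) + 1)) (s / (1 - s) ^ 2) := by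
  have hnorm : ‖s‖ < 1 := by
    rw [Real.norm_of_nonneg hs.1.le]
    exact hs.2
  have h := (hasSum_nat_add_iff' (f := fun n : ℕ => (n : ℝ) * s ^ n) 1).mpr
    (hasSum_coe_mul_geometric_of_norm_lt_one hnorm)
  simpa [mul_comm] using h

theorem hasSum_pow_succ {s : ℝ} (hs : s ∈ Set.Ioo (0 : ℝ) 1) :
    HasSum (fun j : ℕ => s ^ (j + 1)) (s / (1 - s)) := by
  simpa [pow_succ', div_eq_mul_inv] using
    (hasSum_geometric_of_lt_one hs.1.le hs.2).mul_left s

/-- A weighted power series whose coefficients stay within `1` of `(j + 1) x` is close to the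
one with coefficients `(j + 1) x`, which sums to `x / s`. -/
theorem abs_weighted_tsum_sub_le {s x : ℝ} (hs : s ∈ Set.Ioo (0 : ℝ) 1) {a : ℕ → ℝ}
    (ha : ∀ j : ℕ, |a j - ((j : ℝ) + 1) * x| ≤ 1) :
    |((1 - s) / s) ^ 2 * ∑' j : ℕ, s ^ (j + 1) * a j - x / s| ≤ (1 - s) / s := by
  have hs0 : s ≠ 0 := hs.1.ne'
  have hs1 : 1 - s ≠ 0 := (sub_pos.mpr hs.2).ne'
  have hbound (j : ℕ) : ‖s ^ (j + 1) * (a j - ((j : ℝ) + 1) * x)‖ ≤ s ^ (j + 1) := by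
    have hpow : 0 ≤ s ^ (j + 1) := pow_nonneg hs.1.le _
    rw [norm_mul, Real.norm_of_nonneg hpow]
    exact mul_le_of_le_one_right hpow (ha j)
  have herr : Summable fun j : ℕ => s ^ (j + 1) * (a j - ((j : ℝ) + 1) * x) :=
    .of_norm_bounded (hasSum_pow_succ hs).summable hbound
  have hle : |∑' j : ℕ, s ^ (j + 1) * (a j - ((j : ℝ) + 1) * x)| ≤ s / (1 - s) :=
    tsum_of_norm_bounded (hasSum_pow_succ hs) hbound
  have hsum : ∑' j : ℕ, s ^ (j + 1) * a j =
      ∑' j : ℕ, s ^ (j + 1) * (a j - ((j : ℝ) + 1) * x) + s / (1 - s) ^ 2 * x := by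
    rw [← (herr.hasSum.add ((hasSum_pow_succ_mul_succ hs).mul_right x)).tsum_eq]
    exact tsum_congr fun j => by ring
  have hmain : ((1 - s) / s) ^ 2 * ∑' j : ℕ, s ^ (j + 1) * a j - x / s =
      ((1 - s) / s) ^ 2 * ∑' j : ℕ, s ^ (j + 1) * (a j - ((j : ℝ) + 1) * x) := by
    rw [hsum, mul_add, add_sub_assoc, add_eq_left]
    field_simp
    ring
  rw [hmain, abs_mul, abs_of_nonneg (sq_nonneg _)]
  calc _ ≤ ((1 - s) / s) ^ 2 * (s / (1 - s)) := by gcongr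
    _ = (1 - s) / s := by field_simp

theorem tendsto_one_sub_div_self :
    Filter.Tendsto (fun s : ℝ => (1 - s) / s) (nhdsWithin 1 (Set.Ioo 0 1)) (nhds 0) := by
  have h : ContinuousAt (fun s : ℝ => (1 - s) / s) 1 := by fun_prop (disch := norm_num)
  simpa using h.tendsto.mono_left nhdsWithin_le_nhds

theorem tendsto_weighted_tsum {x : ℝ} {a : ℕ → ℝ}
    (ha : ∀ j : ℕ, |a j - ((j : ℝ) + 1) * x| ≤ 1) :
    Filter.Tendsto (fun s : ℝ => ((1 - s) / s) ^ 2 * ∑' j : ℕ, s ^ (j + 1) * a j)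
      (nhdsWithin 1 (Set.Ioo 0 1)) (nhds x) := by
  have hdiv : Filter.Tendsto (fun s : ℝ => x / s) (nhdsWithin 1 (Set.Ioo 0 1)) (nhds x) := by
    have h : ContinuousAt (fun s : ℝ => x / s) 1 := by fun_prop (disch := norm_num)
    simpa using h.tendsto.mono_left nhdsWithin_le_nhds
  have hdiff := squeeze_zero_norm'
    (f := fun s : ℝ => ((1 - s) / s) ^ 2 * ∑' j : ℕ, s ^ (j + 1) * a j - x / s) (Filter.eventually_of_mem self_mem_nhdsWithin
    fun s hs => abs_weighted_tsum_sub_le hs ha) tendsto_one_sub_div_self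
  simpa using hdiff.add hdiv

theorem stmt_10 (x : ℝ) :
    Filter.Tendsto (fun s => DeltaMinus s x) (nhdsWithin 1 (Set.Ioo 0 1)) (nhds x) ∧
    Filter.Tendsto (fun s => DeltaPlus s x) (nhdsWithin 1 (Set.Ioo 0 1)) (nhds x) := by
  constructor
  · refine tendsto_weighted_tsum fun j => abs_le.mpr ⟨?_, ?_⟩
    · linarith [Int.le_ceil (((j : ℝ) + 1) * x)]
    · linarith [Int.ceil_lt_add_one (((j : ℝ) + 1) * x)]
  · have hfloor : ∀ j : ℕ, |((⌊((j : ℝ) + 1) * x⌋ : ℤ) : ℝ) - ((j : ℝ) + 1) * x| ≤ 1 :=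
      fun j => abs_le.mpr ⟨by linarith [Int.lt_floor_add_one (((j : ℝ) + 1) * x)],
        by linarith [Int.floor_le (((j : ℝ) + 1) * x)]⟩
    simpa only [DeltaPlus, zero_add] using
      tendsto_one_sub_div_self.add (tendsto_weighted_tsum hfloor)
end

section
/- Let 0 < s < 1 and ξ > 0. The functions Υ_{s,ξ}⁻ and Υ_{s,ξ}⁺ are monotone non-decreasing on ℝ; moreover, if ξ is irrational, then Υ_{s,ξ}⁻ and Υ_{s,ξ}⁺ are strictly increasing on ℝ. -/
open scoped BigOperators

/-- `Υ_{s,ξ}⁻(x) = ((1−s)/s) · ∑_{j=1}^∞ s^j ⌈x − {jξ}⌉`. -/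
noncomputable def UpsilonMinus (s ξ x : ℝ) : ℝ :=
  (1 - s) / s * ∑' j : ℕ, s ^ (j + 1) * ((⌈x - Int.fract (((j : ℝ) + 1) * ξ)⌉ : ℤ) : ℝ)

/-- `Υ_{s,ξ}⁺(x) = 1 + ((1−s)/s) · ∑_{j=1}^∞ s^j ⌊x − {jξ}⌋`. -/
noncomputable def UpsilonPlus (s ξ x : ℝ) : ℝ :=
  1 + (1 - s) / s * ∑' j : ℕ, s ^ (j + 1) * ((⌊x - Int.fract (((j : ℝ) + 1) * ξ)⌋ : ℤ) : ℝ)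

theorem summable_geometric_mul_of_abs_le {s C : ℝ} (hs0 : 0 < s) (hs1 : s < 1) {a : ℕ → ℝ}
    (ha : ∀ j, |a j| ≤ C) : Summable fun j : ℕ => s ^ (j + 1) * a j := by
  have hg : Summable fun j : ℕ => s ^ (j + 1) * C :=
    ((summable_nat_add_iff 1).2 (summable_geometric_of_lt_one hs0.le hs1)).mul_right C
  refine Summable.of_norm_bounded hg fun j => ?_
  rw [Real.norm_eq_abs, abs_mul, abs_of_pos (pow_pos hs0 _)]
  exact mul_le_mul_of_nonneg_left (ha j) (pow_pos hs0 _).le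

theorem abs_ceil_sub_fract_le (x t : ℝ) : |((⌈x - Int.fract t⌉ : ℤ) : ℝ)| ≤ |x| + 1 := by
  have h0 := Int.fract_nonneg t
  have h1 := (Int.fract_lt_one t).le
  have h2 := Int.le_ceil (x - Int.fract t)
  have h3 : ((⌈x - Int.fract t⌉ : ℤ) : ℝ) ≤ ⌈x⌉ := by
    exact_mod_cast Int.ceil_mono (by linarith)
  have h4 := Int.ceil_lt_add_one x
  rw [abs_le]
  constructor <;> linarith [neg_abs_le x, le_abs_self x]

theorem abs_floor_sub_fract_le (x t : ℝ) : |((⌊x - Int.fract t⌋ : ℤ) : ℝ)| ≤ |x| + 2 := by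
  have h0 := Int.fract_nonneg t
  have h1 := Int.fract_lt_one t
  have h2 := Int.floor_le (x - Int.fract t)
  have h3 := Int.lt_floor_add_one (x - Int.fract t)
  rw [abs_le]
  constructor <;> linarith [neg_abs_le x, le_abs_self x]

/-- Positive multiples of an irrational number are dense modulo one. -/
theorem Irrational.exists_succ_mul_add_int_mem_Ioo {ξ : ℝ} (hξ : Irrational ξ) {x y : ℝ}
    (hxy : x < y) : ∃ (j : ℕ) (m : ℤ), ((j : ℝ) + 1) * ξ + m ∈ Set.Ioo x y := by
  have : Fact ((0 : ℝ) < 1) := ⟨one_pos⟩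
  have hd : DenseRange (· • (ξ : AddCircle (1 : ℝ)) : ℕ → AddCircle (1 : ℝ)) :=
    denseRange_zsmul_iff_nsmul.1 (AddCircle.denseRange_zsmul_coe_iff.2 (by simpa using hξ))
  have ho : IsOpen ((QuotientAddGroup.mk : ℝ → AddCircle (1 : ℝ)) '' Set.Ioo (x - ξ) (y - ξ)) :=
    QuotientAddGroup.isOpenMap_coe _ isOpen_Ioo
  obtain ⟨j, z, hz, hj⟩ := hd.exists_mem_open ho
    ((Set.nonempty_Ioo.2 (by linarith)).image _)
  have hj' : ((z : ℝ) : AddCircle (1 : ℝ)) = ((j • ξ : ℝ) : AddCircle (1 : ℝ)) := by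
    simpa using hj
  obtain ⟨m, hm⟩ := AddSubgroup.mem_zmultiples_iff.1 (QuotientAddGroup.eq.1 hj')
  refine ⟨j, -m, ?_⟩
  have hz' : ((j : ℝ) + 1) * ξ + ((-m : ℤ) : ℝ) = z + ξ := by
    simp only [zsmul_eq_mul, nsmul_eq_mul, mul_one] at hm
    push_cast
    linarith
  rw [hz']
  constructor <;> linarith [hz.1, hz.2]

theorem Irrational.exists_int_between_sub_fract {ξ : ℝ} (hξ : Irrational ξ) {x y : ℝ}
    (hxy : x < y) : ∃ (j : ℕ) (k : ℤ),
      x - Int.fract (((j : ℝ) + 1) * ξ) < k ∧ (k : ℝ) < y - Int.fract (((j : ℝ) + 1) * ξ) := by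
  obtain ⟨j, m, hx, hy⟩ := hξ.exists_succ_mul_add_int_mem_Ioo hxy
  have h := Int.floor_add_fract (((j : ℝ) + 1) * ξ)
  refine ⟨j, ⌊((j : ℝ) + 1) * ξ⌋ + m, ?_, ?_⟩ <;> push_cast <;> linarith

theorem stmt_11 (s ξ : ℝ) (hs0 : 0 < s) (hs1 : s < 1) (hξ : 0 < ξ) :
    (Monotone (UpsilonMinus s ξ) ∧ Monotone (UpsilonPlus s ξ)) ∧
    (Irrational ξ → StrictMono (UpsilonMinus s ξ) ∧ StrictMono (UpsilonPlus s ξ)) := by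
  have hc : 0 < (1 - s) / s := div_pos (sub_pos.2 hs1) hs0
  have hp : ∀ j : ℕ, 0 < s ^ (j + 1) := fun j => pow_pos hs0 _
  have hsm : ∀ x, Summable fun j : ℕ =>
      s ^ (j + 1) * ((⌈x - Int.fract (((j : ℝ) + 1) * ξ)⌉ : ℤ) : ℝ) := fun x =>
    summable_geometric_mul_of_abs_le hs0 hs1 fun j => abs_ceil_sub_fract_le x _
  have hsp : ∀ x, Summable fun j : ℕ =>
      s ^ (j + 1) * ((⌊x - Int.fract (((j : ℝ) + 1) * ξ)⌋ : ℤ) : ℝ) := fun x =>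
    summable_geometric_mul_of_abs_le hs0 hs1 fun j => abs_floor_sub_fract_le x _
  have hlm : ∀ x y : ℝ, x ≤ y → ∀ j : ℕ,
      s ^ (j + 1) * ((⌈x - Int.fract (((j : ℝ) + 1) * ξ)⌉ : ℤ) : ℝ) ≤
      s ^ (j + 1) * ((⌈y - Int.fract (((j : ℝ) + 1) * ξ)⌉ : ℤ) : ℝ) := fun x y h j =>
    mul_le_mul_of_nonneg_left (Int.cast_le.2 (Int.ceil_mono (sub_le_sub_right h _))) (hp j).le
  have hlp : ∀ x y : ℝ, x ≤ y → ∀ j : ℕ,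
      s ^ (j + 1) * ((⌊x - Int.fract (((j : ℝ) + 1) * ξ)⌋ : ℤ) : ℝ) ≤
      s ^ (j + 1) * ((⌊y - Int.fract (((j : ℝ) + 1) * ξ)⌋ : ℤ) : ℝ) := fun x y h j =>
    mul_le_mul_of_nonneg_left (Int.cast_le.2 (Int.floor_mono (sub_le_sub_right h _))) (hp j).le
  refine ⟨⟨fun x y h => ?_, fun x y h => ?_⟩, fun hirr => ⟨fun x y h => ?_, fun x y h => ?_⟩⟩
  · exact mul_le_mul_of_nonneg_left ((hsm x).tsum_le_tsum (hlm x y h) (hsm y)) hc.le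
  · exact add_le_add_right
      (mul_le_mul_of_nonneg_left ((hsp x).tsum_le_tsum (hlp x y h) (hsp y)) hc.le) _
  · obtain ⟨j, k, hx, hy⟩ := hirr.exists_int_between_sub_fract h
    refine mul_lt_mul_of_pos_left (Summable.tsum_lt_tsum (i := j) (hlm x y h.le) ?_
      (hsm x) (hsm y)) hc
    exact mul_lt_mul_of_pos_left
      (Int.cast_lt.2 ((Int.ceil_le.2 hx.le).trans_lt (Int.lt_ceil.2 hy))) (hp j)
  · obtain ⟨j, k, hx, hy⟩ := hirr.exists_int_between_sub_fract h
    refine add_lt_add_right (mul_lt_mul_of_pos_left (Summable.tsum_lt_tsum (i := j)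
      (hlp x y h.le) ?_ (hsp x) (hsp y)) hc) _
    exact mul_lt_mul_of_pos_left
      (Int.cast_lt.2 ((Int.floor_lt.2 hx).trans_le (Int.le_floor.2 hy.le))) (hp j)
end

section
/- Let 0 < s < 1 and let ξ > 0 be irrational. If x = a + bξ for some integer a and some positive integer b, then Υ_{s,ξ}⁺(x) − Υ_{s,ξ}⁻(x) = (1−s)·s^{b−1}. For every real x not of this form, Υ_{s,ξ}⁺(x) = Υ_{s,ξ}⁻(x). -/
open scoped BigOperators

theorem summable_pow_succ_mul_intCast {s C : ℝ} (hs0 : 0 < s) (hs1 : s < 1) (f : ℕ → ℤ)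
    (hf : ∀ j, |(f j : ℝ)| ≤ C) : Summable fun j : ℕ => s ^ (j + 1) * (f j : ℝ) := by
  refine Summable.of_norm_bounded (g := fun j : ℕ => s ^ j * (s * C))
    ((summable_geometric_of_lt_one hs0.le hs1).mul_right _) fun j => ?_
  rw [Real.norm_eq_abs, abs_mul, abs_of_pos (pow_pos hs0 _), pow_succ, mul_assoc]
  gcongr
  exact hf j

theorem sub_fract_mem_range_intCast_iff (x y : ℝ) :
    (∃ n : ℤ, x - Int.fract y = n) ↔ ∃ a : ℤ, x = a + y := by
  constructor
  · rintro ⟨n, hn⟩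
    refine ⟨n - ⌊y⌋, ?_⟩
    have := Int.floor_add_fract y
    push_cast
    linarith
  · rintro ⟨a, rfl⟩
    refine ⟨a + ⌊y⌋, ?_⟩
    have := Int.floor_add_fract y
    push_cast
    linarith

open scoped Classical in
theorem one_add_floor_sub_ceil (y : ℝ) :
    1 + (⌊y⌋ : ℝ) - (⌈y⌉ : ℝ) = if ∃ n : ℤ, y = n then 1 else 0 := by
  split_ifs with h
  · obtain ⟨n, rfl⟩ := h
    simp
  · have h1 : ⌊y⌋ < ⌈y⌉ := by
      have h2 : (⌊y⌋ : ℝ) < y :=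
        lt_of_le_of_ne (Int.floor_le y) fun he => h ⟨_, he.symm⟩
      exact_mod_cast h2.trans_le (Int.le_ceil y)
    have h3 : ⌈y⌉ = ⌊y⌋ + 1 := le_antisymm (Int.ceil_le_floor_add_one y) h1
    rw [h3]
    push_cast
    ring

open scoped Classical in
theorem UpsilonPlus_sub_UpsilonMinus {s : ℝ} (hs0 : 0 < s) (hs1 : s < 1) (ξ x : ℝ) :
    UpsilonPlus s ξ x - UpsilonMinus s ξ x = (1 - s) / s *
      ∑' j : ℕ, s ^ (j + 1) * (if ∃ a : ℤ, x = a + ((j : ℝ) + 1) * ξ then 1 else 0) := by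
  have hfloor : Summable fun j : ℕ =>
      s ^ (j + 1) * ((⌊x - Int.fract (((j : ℝ) + 1) * ξ)⌋ : ℤ) : ℝ) := by
    refine summable_pow_succ_mul_intCast (C := |x| + 2) hs0 hs1 _ fun j => abs_le.2 ?_
    have h1 := Int.fract_nonneg (((j : ℝ) + 1) * ξ)
    have h2 := Int.fract_lt_one (((j : ℝ) + 1) * ξ)
    have h3 := Int.floor_le (x - Int.fract (((j : ℝ) + 1) * ξ))
    have h4 := Int.lt_floor_add_one (x - Int.fract (((j : ℝ) + 1) * ξ))
    constructor <;> linarith [le_abs_self x, neg_abs_le x]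
  have hceil : Summable fun j : ℕ =>
      s ^ (j + 1) * ((⌈x - Int.fract (((j : ℝ) + 1) * ξ)⌉ : ℤ) : ℝ) := by
    refine summable_pow_succ_mul_intCast (C := |x| + 2) hs0 hs1 _ fun j => abs_le.2 ?_
    have h1 := Int.fract_nonneg (((j : ℝ) + 1) * ξ)
    have h2 := Int.fract_lt_one (((j : ℝ) + 1) * ξ)
    have h3 := Int.le_ceil (x - Int.fract (((j : ℝ) + 1) * ξ))
    have h4 := Int.ceil_lt_add_one (x - Int.fract (((j : ℝ) + 1) * ξ))
    constructor <;> linarith [le_abs_self x, neg_abs_le x]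
  have hgeom : HasSum (fun j : ℕ => s ^ (j + 1)) (s / (1 - s)) := by
    simpa [pow_succ', div_eq_mul_inv] using
      (hasSum_geometric_of_lt_one hs0.le hs1).mul_left s
  have hsum := ((hgeom.add hfloor.hasSum).sub hceil.hasSum).tsum_eq
  have hs2 : 1 - s ≠ 0 := by linarith
  have hterm : ∀ j : ℕ,
      s ^ (j + 1) * (if ∃ a : ℤ, x = a + ((j : ℝ) + 1) * ξ then (1 : ℝ) else 0) =
      s ^ (j + 1) + s ^ (j + 1) * ((⌊x - Int.fract (((j : ℝ) + 1) * ξ)⌋ : ℤ) : ℝ) -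
        s ^ (j + 1) * ((⌈x - Int.fract (((j : ℝ) + 1) * ξ)⌉ : ℤ) : ℝ) := fun j => by
    simp only [← sub_fract_mem_range_intCast_iff]
    rw [← one_add_floor_sub_ceil]
    ring
  have hone : (1 - s) / s * (s / (1 - s)) = 1 := by field_simp
  rw [tsum_congr hterm, hsum, UpsilonPlus, UpsilonMinus, mul_sub, mul_add, hone]

theorem Irrational.eq_of_intCast_add_mul_eq {ξ : ℝ} (hξ : Irrational ξ) {a b c d : ℤ}
    (h : (a : ℝ) + b * ξ = c + d * ξ) : b = d := by
  by_contra hne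
  refine (hξ.intCast_mul (sub_ne_zero.2 hne)).ne_int (c - a) ?_
  push_cast
  linarith

theorem stmt_12 (s ξ : ℝ) (hs0 : 0 < s) (hs1 : s < 1) (hξ : 0 < ξ)
    (hirr : Irrational ξ) :
    (∀ x : ℝ, ∀ a b : ℤ, 0 < b → x = a + b * ξ →
      UpsilonPlus s ξ x - UpsilonMinus s ξ x = (1 - s) * s ^ (b - 1)) ∧
    (∀ x : ℝ, (¬ ∃ a b : ℤ, 0 < b ∧ x = a + b * ξ) →
      UpsilonPlus s ξ x = UpsilonMinus s ξ x) := by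
  classical
  refine ⟨fun x a b hb hx => ?_, fun x hx => ?_⟩
  · obtain ⟨k, rfl⟩ : ∃ k : ℕ, b = k + 1 := ⟨(b - 1).toNat, by omega⟩
    rw [UpsilonPlus_sub_UpsilonMinus hs0 hs1, tsum_eq_single k, if_pos]
    · rw [add_sub_cancel_right, zpow_natCast, pow_succ]
      field_simp
    · exact ⟨a, by rw [hx]; push_cast; rfl⟩
    · intro j hj
      rw [if_neg, mul_zero]
      rintro ⟨c, hc⟩
      have h : ((k : ℤ) + 1) = (j : ℤ) + 1 :=
        hirr.eq_of_intCast_add_mul_eq (a := a) (c := c) (by rw [← hx, hc]; push_cast; rfl)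
      omega
  · rw [← sub_eq_zero, UpsilonPlus_sub_UpsilonMinus hs0 hs1]
    have h : ∀ j : ℕ, ¬ ∃ a : ℤ, x = a + ((j : ℝ) + 1) * ξ := fun j ⟨a, ha⟩ =>
      hx ⟨a, j + 1, by omega, by rw [ha]; push_cast; rfl⟩
    simp [h]
end

section
/- Let k and n be positive integers with gcd(k,n) = 1. Then for every x ∈ ℝ, lim_{s→1⁻} Υ_{s,k/n}⁻(x) = ⌈nx⌉/n and lim_{s→1⁻} Υ_{s,k/n}⁺(x) = ⌊nx+1⌋/n, where the limits are taken as s tends to 1 from below within (0,1). -/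
open scoped BigOperators

theorem tsum_pow_mul_of_periodic {a : ℕ → ℝ} {n : ℕ} (hn : 0 < n) (ha : Function.Periodic a n)
    {s : ℝ} (hs : s ∈ Set.Ioo (0 : ℝ) 1) :
    (1 - s) / s * ∑' j, s ^ (j + 1) * a j =
      (∑ j ∈ Finset.range n, s ^ j * a j) / ∑ j ∈ Finset.range n, s ^ j := by
  have hs0 := hs.1
  have hs1 : 0 < 1 - s := by linarith [hs.2]
  have hbound (j : ℕ) : |a j| ≤ ∑ r ∈ Finset.range n, |a r| := by
    rw [← ha.map_mod_nat j]
    exact Finset.single_le_sum (f := fun r => |a r|) (fun _ _ => abs_nonneg _)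
      (Finset.mem_range.2 (Nat.mod_lt j hn))
  have hsum : Summable fun j => s ^ j * a j := by
    refine Summable.of_norm_bounded
      ((summable_geometric_of_lt_one hs0.le hs.2).mul_right (∑ r ∈ Finset.range n, |a r|)) fun j => ?_
    rw [norm_mul, norm_pow, Real.norm_eq_abs, Real.norm_eq_abs, abs_of_pos hs0]
    exact mul_le_mul_of_nonneg_left (hbound j) (by positivity)
  have hshift : ∑' j, s ^ (j + n) * a (j + n) = s ^ n * ∑' j, s ^ j * a j := by
    rw [← tsum_mul_left]
    refine tsum_congr fun j => ?_
    rw [ha j]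
    ring
  have hsplit := hsum.sum_add_tsum_nat_add n
  rw [hshift] at hsplit
  have hgeom := geom_sum_mul_neg s n
  have hpos : 0 < ∑ j ∈ Finset.range n, s ^ j :=
    Finset.sum_pos (fun _ _ => by positivity) (Finset.nonempty_range_iff.2 hn.ne')
  have hfactor : ∑' j, s ^ (j + 1) * a j = s * ∑' j, s ^ j * a j := by
    rw [← tsum_mul_left]
    exact tsum_congr fun j => by ring
  rw [hfactor, eq_div_iff hpos.ne']
  field_simp
  linear_combination (∑' j, s ^ j * a j) * hgeom - hsplit

theorem tendsto_abel_mean_of_periodic {a : ℕ → ℝ} {n : ℕ} (hn : 0 < n)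
    (ha : Function.Periodic a n) :
    Filter.Tendsto (fun s : ℝ => (1 - s) / s * ∑' j, s ^ (j + 1) * a j)
      (nhdsWithin 1 (Set.Ioo 0 1)) (nhds ((∑ j ∈ Finset.range n, a j) / n)) := by
  have hcont : ContinuousAt (fun s : ℝ => (∑ j ∈ Finset.range n, s ^ j * a j) /
      ∑ j ∈ Finset.range n, s ^ j) 1 := by
    refine ContinuousAt.div (by fun_prop) (by fun_prop) ?_
    simp [hn.ne']
  have hlim := hcont.tendsto.mono_left (nhdsWithin_le_nhds (s := Set.Ioo 0 1))
  simp only [one_pow, one_mul, Finset.sum_const, Finset.card_range, nsmul_eq_mul, mul_one] at hlim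
  refine hlim.congr' ?_
  filter_upwards [self_mem_nhdsWithin] with s hs
  exact (tsum_pow_mul_of_periodic hn ha hs).symm

theorem sum_range_int_sub_ediv {n : ℕ} (hn : 0 < n) (N : ℤ) :
    ∑ r ∈ Finset.range n, (N - r) / (n : ℤ) = N - n + 1 := by
  have hn' : (n : ℤ) ≠ 0 := by exact_mod_cast hn.ne'
  have hstep (M : ℤ) : ∑ r ∈ Finset.range n, (M + 1 - r) / (n : ℤ) =
      ∑ r ∈ Finset.range n, (M - r) / (n : ℤ) + 1 := by
    have htel := Finset.sum_range_sub' (fun r : ℕ => (M + 1 - r) / (n : ℤ)) n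
    have hlast : (M + 1 - n) / (n : ℤ) = (M + 1) / (n : ℤ) - 1 := by
      rw [Int.sub_ediv_of_dvd _ (dvd_refl _), Int.ediv_self hn']
    rw [← sub_eq_iff_eq_add', ← Finset.sum_sub_distrib]
    simp only [Nat.cast_zero, sub_zero, hlast, sub_sub_cancel] at htel
    refine Eq.trans ?_ htel
    refine Finset.sum_congr rfl fun r _ => ?_
    rw [show M + 1 - ((r + 1 : ℕ) : ℤ) = M - r by push_cast; ring]
  induction N using Int.inductionOn' (b := (n : ℤ) - 1) with
  | zero =>
    rw [Finset.sum_eq_zero fun r hr => ?_]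
    · ring
    · have hr := Finset.mem_range.1 hr
      exact Int.ediv_eq_zero_of_lt (by omega) (by omega)
  | succ M _ ih => rw [hstep, ih]; ring
  | pred M _ ih =>
    have h := hstep (M - 1)
    rw [sub_add_cancel, ih] at h
    linarith

theorem sum_range_floor_sub_div {n : ℕ} (hn : 0 < n) (x : ℝ) :
    ∑ r ∈ Finset.range n, ⌊x - r / n⌋ = ⌊n * x⌋ - n + 1 := by
  rw [← sum_range_int_sub_ediv hn]
  refine Finset.sum_congr rfl fun r _ => ?_
  have hn' : (n : ℝ) ≠ 0 := by exact_mod_cast hn.ne'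
  rw [show x - r / n = (n * x - (r : ℤ)) / n by push_cast; field_simp, Int.floor_div_natCast,
    Int.floor_sub_intCast]

theorem sum_range_ceil_sub_div {n : ℕ} (hn : 0 < n) (x : ℝ) :
    ∑ r ∈ Finset.range n, ⌈x - r / n⌉ = ⌈n * x⌉ := by
  have hn' : (n : ℝ) ≠ 0 := by exact_mod_cast hn.ne'
  have h := sum_range_floor_sub_div hn (-x + (n - 1) / n)
  rw [← Finset.sum_range_reflect, show (n : ℝ) * (-x + (n - 1) / n) = -(n * x) + ((n - 1 : ℤ) : ℝ) by
    push_cast; field_simp, Int.floor_add_intCast, Int.floor_neg] at h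
  have hterm : ∑ r ∈ Finset.range n, ⌈x - r / n⌉ = -∑ r ∈ Finset.range n,
      ⌊-x + (n - 1) / n - ((n - 1 - r : ℕ) : ℝ) / n⌋ := by
    rw [← Finset.sum_neg_distrib]
    refine Finset.sum_congr rfl fun r hr => ?_
    have hr := Finset.mem_range.1 hr
    rw [← Int.ceil_neg, Nat.cast_sub (by omega), Nat.cast_sub (by omega)]
    congr 1
    push_cast
    ring
  rw [hterm, h]
  ring

theorem fract_succ_mul_div (k n j : ℕ) :
    Int.fract (((j : ℝ) + 1) * (k / n)) = (((j + 1) * k % n : ℕ) : ℝ) / n := by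
  rw [← Int.fract_div_natCast_eq_div_natCast_mod]
  push_cast
  rw [mul_div_assoc]

theorem sum_range_succ_mul_mod {M : Type*} [AddCommMonoid M] {k n : ℕ} (hn : 0 < n)
    (hkn : Nat.Coprime k n) (f : ℕ → M) :
    ∑ j ∈ Finset.range n, f ((j + 1) * k % n) = ∑ r ∈ Finset.range n, f r := by
  have hmaps : Set.MapsTo (fun j => (j + 1) * k % n) (Finset.range n) (Finset.range n) :=
    fun j _ => by simpa using Nat.mod_lt _ hn
  have hinj : Set.InjOn (fun j => (j + 1) * k % n) (Finset.range n) := by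
    intro i hi j hj hij
    have hmod : i + 1 ≡ j + 1 [MOD n] := Nat.ModEq.cancel_right_of_coprime hkn.symm hij
    exact (Nat.ModEq.add_right_cancel' 1 hmod).eq_of_lt_of_lt
      (by simpa using hi) (by simpa using hj)
  exact Finset.sum_nbij _ hmaps hinj (Finset.surjOn_of_injOn_of_card_le _ hmaps hinj le_rfl)
    fun _ _ => rfl

theorem periodic_fract_succ_mul_div {n : ℕ} (k : ℕ) :
    Function.Periodic (fun j : ℕ => Int.fract (((j : ℝ) + 1) * (k / n))) n := by
  intro j
  simp only [fract_succ_mul_div]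
  congr 2
  rw [show (j + n + 1) * k = (j + 1) * k + n * k by ring, Nat.add_mul_mod_self_left]

theorem stmt_14 (k n : ℕ) (hk : 0 < k) (hn : 0 < n) (hgcd : Nat.gcd k n = 1) (x : ℝ) :
    Filter.Tendsto (fun s => UpsilonMinus s ((k : ℝ) / (n : ℝ)) x)
      (nhdsWithin 1 (Set.Ioo 0 1)) (nhds (((⌈(n : ℝ) * x⌉ : ℤ) : ℝ) / n)) ∧
    Filter.Tendsto (fun s => UpsilonPlus s ((k : ℝ) / (n : ℝ)) x)
      (nhdsWithin 1 (Set.Ioo 0 1)) (nhds (((⌊(n : ℝ) * x + 1⌋ : ℤ) : ℝ) / n)) := by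
  have hn' : (n : ℝ) ≠ 0 := by exact_mod_cast hn.ne'
  constructor
  · have h := tendsto_abel_mean_of_periodic hn
      ((periodic_fract_succ_mul_div (n := n) k).comp fun t => ((⌈x - t⌉ : ℤ) : ℝ))
    simp only [Function.comp_apply, fract_succ_mul_div] at h
    rw [sum_range_succ_mul_mod hn hgcd fun r : ℕ => ((⌈x - r / n⌉ : ℤ) : ℝ), ← Int.cast_sum,
      sum_range_ceil_sub_div hn] at h
    simpa only [UpsilonMinus, fract_succ_mul_div] using h
  · have h := (tendsto_abel_mean_of_periodic hn
      ((periodic_fract_succ_mul_div (n := n) k).comp fun t => ((⌊x - t⌋ : ℤ) : ℝ))).const_add 1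
    simp only [Function.comp_apply, fract_succ_mul_div] at h
    rw [sum_range_succ_mul_mod hn hgcd fun r : ℕ => ((⌊x - r / n⌋ : ℤ) : ℝ), ← Int.cast_sum,
      sum_range_floor_sub_div hn] at h
    have hvalue : ((⌊(n : ℝ) * x + 1⌋ : ℤ) : ℝ) / n =
        1 + ((⌊(n : ℝ) * x⌋ - n + 1 : ℤ) : ℝ) / n := by
      rw [Int.floor_add_one]
      push_cast
      field_simp
      ring
    rw [hvalue]
    simpa only [UpsilonPlus, fract_succ_mul_div] using h
end

section
/- For every s with 0 < s < 1, the set C_s (the closure in ℝ of the union of the images of Δ_s⁻ and Δ_s⁺) has Hausdorff dimension 0. -/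
open scoped BigOperators

open MeasureTheory Filter Topology

/-- A set of reals covered, at every stage `n`, by polynomially many sets of geometrically small
diameter has Hausdorff dimension zero. -/
theorem dimH_eq_zero_of_polynomial_cover {s : ℝ} (hs0 : 0 < s) (hs1 : s < 1) {T : Set ℝ} {A : ℝ}
    (hA : 0 ≤ A) (L : ℕ) (t : ℕ → ℤ → Set ℝ)
    (hdiam : ∀ n m, Metric.ediam (t n m) ≤ ENNReal.ofReal (A * ((n + 1 : ℕ) * s ^ n)))
    (hcov : ∀ n : ℕ, T ⊆ ⋃ m : Finset.Icc (-(L * n ^ 2 : ℤ)) (L * n ^ 2), t n m) :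
    dimH T = 0 := by
  have shifted : ∀ (k : ℕ) (r : ℝ), 0 < r → r < 1 →
      Tendsto (fun n : ℕ => ((n + 1 : ℕ) : ℝ) ^ k * r ^ n) atTop (𝓝 0) := by
    intro k r hr0 hr1
    have h := (tendsto_add_atTop_iff_nat 1).2
      (tendsto_pow_const_mul_const_pow_of_abs_lt_one k (r := r) (by rwa [abs_of_pos hr0]))
    have h2 := h.mul_const r⁻¹
    rw [zero_mul] at h2
    refine h2.congr fun n => ?_
    rw [pow_succ r n]
    field_simp
  by_contra hne
  obtain ⟨d, hd0, hd⟩ := ENNReal.lt_iff_exists_nnreal_btwn.1 (pos_iff_ne_zero.2 hne)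
  have hdpos : (0 : ℝ) < d := by exact_mod_cast hd0
  have hρ0 : 0 < s ^ (d : ℝ) := Real.rpow_pos_of_pos hs0 _
  have hρ1 : s ^ (d : ℝ) < 1 := Real.rpow_lt_one hs0.le hs1 hdpos
  refine absurd (dimH_le_of_hausdorffMeasure_ne_top (s := T) (d := d) ?_) (not_le.2 hd)
  have hr : Tendsto (fun n : ℕ => ENNReal.ofReal (A * ((n + 1 : ℕ) * s ^ n))) atTop (𝓝 0) := by
    have h := (shifted 1 s hs0 hs1).const_mul A
    simpa using ENNReal.tendsto_ofReal h
  have key := Measure.hausdorffMeasure_le_liminf_sum (d : ℝ) T _ hr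
    (fun n (m : Finset.Icc (-(L * n ^ 2 : ℤ)) (L * n ^ 2)) => t n m)
    (Eventually.of_forall fun n m => hdiam n m) (Eventually.of_forall hcov)
  have hbound : ∀ n : ℕ, ∑ m : Finset.Icc (-(L * n ^ 2 : ℤ)) (L * n ^ 2),
      Metric.ediam (t n m) ^ (d : ℝ) ≤ ENNReal.ofReal ((2 * L + 1) * A ^ (d : ℝ) *
        (((n + 1 : ℕ) : ℝ) ^ (2 + ⌈(d : ℝ)⌉₊) * (s ^ (d : ℝ)) ^ n)) := by
    intro n
    have hn1 : (1 : ℝ) ≤ (n + 1 : ℕ) := by push_cast; linarith [Nat.cast_nonneg (α := ℝ) n]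
    have hcard : (Finset.univ : Finset (Finset.Icc (-(L * n ^ 2 : ℤ)) (L * n ^ 2))).card
        = 2 * L * n ^ 2 + 1 := by
      rw [Finset.card_univ, Fintype.card_coe, Int.card_Icc]
      have : (L * n ^ 2 + 1 - -(L * n ^ 2) : ℤ) = ((2 * L * n ^ 2 + 1 : ℕ) : ℤ) := by
        push_cast; ring
      rw [this, Int.toNat_natCast]
    calc _ ≤ Finset.card (Finset.univ : Finset (Finset.Icc (-(L * n ^ 2 : ℤ)) (L * n ^ 2))) •
          ENNReal.ofReal (A * ((n + 1 : ℕ) * s ^ n)) ^ (d : ℝ) :=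
          Finset.sum_le_card_nsmul _ _ _ fun m _ =>
            ENNReal.rpow_le_rpow (hdiam n m) hdpos.le
      _ = ENNReal.ofReal (((2 * L * n ^ 2 + 1 : ℕ) : ℝ) *
            (A * ((n + 1 : ℕ) * s ^ n)) ^ (d : ℝ)) := by
          rw [hcard, nsmul_eq_mul, ENNReal.ofReal_rpow_of_nonneg (by positivity) hdpos.le,
            ENNReal.ofReal_mul (Nat.cast_nonneg _), ENNReal.ofReal_natCast]
      _ ≤ _ := by
          apply ENNReal.ofReal_le_ofReal
          rw [Real.mul_rpow hA (by positivity), Real.mul_rpow (by positivity) (by positivity),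
            ← Real.rpow_pow_comm hs0.le]
          have h1 : ((n + 1 : ℕ) : ℝ) ^ (d : ℝ) ≤ ((n + 1 : ℕ) : ℝ) ^ ⌈(d : ℝ)⌉₊ := by
            rw [← Real.rpow_natCast]
            exact Real.rpow_le_rpow_of_exponent_le hn1 (Nat.le_ceil _)
          have h2 : ((2 * L * n ^ 2 + 1 : ℕ) : ℝ) ≤ (2 * L + 1) * ((n + 1 : ℕ) : ℝ) ^ 2 := by
            have : (2 * L * n ^ 2 + 1 : ℕ) ≤ (2 * L + 1) * (n + 1) ^ 2 := by
              nlinarith [Nat.zero_le (L * n), Nat.zero_le L, Nat.zero_le n]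
            exact_mod_cast this
          have hAd : 0 ≤ A ^ (d : ℝ) := Real.rpow_nonneg hA _
          calc _ ≤ ((2 * L + 1) * ((n + 1 : ℕ) : ℝ) ^ 2) *
                (A ^ (d : ℝ) * (((n + 1 : ℕ) : ℝ) ^ ⌈(d : ℝ)⌉₊ * (s ^ (d : ℝ)) ^ n)) := by
                gcongr
            _ = _ := by rw [pow_add]; ring
  have hlim : Tendsto (fun n : ℕ => ENNReal.ofReal ((2 * L + 1) * A ^ (d : ℝ) *
      (((n + 1 : ℕ) : ℝ) ^ (2 + ⌈(d : ℝ)⌉₊) * (s ^ (d : ℝ)) ^ n))) atTop (𝓝 0) := by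
    have h := (shifted (2 + ⌈(d : ℝ)⌉₊) _ hρ0 hρ1).const_mul ((2 * L + 1) * A ^ (d : ℝ))
    simpa using ENNReal.tendsto_ofReal h
  have hsum := tendsto_of_tendsto_of_tendsto_of_le_of_le tendsto_const_nhds hlim
    (fun n => zero_le) hbound
  rw [hsum.liminf_eq] at key
  exact ne_top_of_le_ne_top ENNReal.zero_ne_top key

theorem summable_pow_succ_mul_succ {s : ℝ} (hs0 : 0 < s) (hs1 : s < 1) :
    Summable fun j : ℕ => s ^ (j + 1) * ((j : ℝ) + 1) := by
  have h := (summable_nat_add_iff 1).2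
    (summable_pow_mul_geometric_of_norm_lt_one 1 (r := s) (by rwa [Real.norm_of_nonneg hs0.le]))
  refine h.congr fun j => ?_
  push_cast
  ring

section RoundedMultiples

variable {s : ℝ} {f : ℕ → ℝ → ℤ}

theorem abs_rounding_le (hf : ∀ j x, |(f j x : ℝ) - ((j : ℝ) + 1) * x| ≤ 1) {K : ℕ} {x : ℝ}
    (hx : |x| ≤ K) (j : ℕ) : |(f j x : ℝ)| ≤ (K + 1) * ((j : ℝ) + 1) := by
  have h1 : |((j : ℝ) + 1) * x| ≤ ((j : ℝ) + 1) * K := by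
    rw [abs_mul, abs_of_nonneg (by positivity : (0 : ℝ) ≤ (j : ℝ) + 1)]
    gcongr
  have h2 := abs_add_le ((f j x : ℝ) - ((j : ℝ) + 1) * x) (((j : ℝ) + 1) * x)
  rw [sub_add_cancel] at h2
  have := hf j x
  have := Nat.cast_nonneg (α := ℝ) j
  linarith

theorem summable_rounding (hs0 : 0 < s) (hs1 : s < 1)
    (hf : ∀ j x, |(f j x : ℝ) - ((j : ℝ) + 1) * x| ≤ 1) (x : ℝ) :
    Summable fun j : ℕ => s ^ (j + 1) * (f j x : ℝ) := by
  refine Summable.of_norm_bounded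
    ((summable_pow_succ_mul_succ hs0 hs1).mul_left ((⌈|x|⌉₊ : ℝ) + 1)) fun j => ?_
  rw [Real.norm_eq_abs, abs_mul, abs_of_pos (pow_pos hs0 _)]
  calc _ ≤ s ^ (j + 1) * ((⌈|x|⌉₊ + 1) * ((j : ℝ) + 1)) := by
        gcongr
        exact abs_rounding_le hf (Nat.le_ceil _) j
    _ = _ := by ring

theorem abs_tsum_rounding_sub_le (hs0 : 0 < s) (hs1 : s < 1)
    (hf : ∀ j x, |(f j x : ℝ) - ((j : ℝ) + 1) * x| ≤ 1) {K : ℕ} {x y : ℝ}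
    (hx : |x| ≤ K) (hy : |y| ≤ K) (n : ℕ) (hxy : ∀ j < n, f j x = f j y) :
    |(∑' j, s ^ (j + 1) * (f j x : ℝ)) - ∑' j, s ^ (j + 1) * (f j y : ℝ)| ≤
      2 * (K + 1) * ((n + 1 : ℕ) * s ^ n) * ∑' j : ℕ, s ^ (j + 1) * ((j : ℝ) + 1) := by
  have hX := summable_rounding hs0 hs1 hf x
  have hY := summable_rounding hs0 hs1 hf y
  rw [← hX.tsum_sub hY, ← (hX.sub hY).sum_add_tsum_nat_add n, Finset.sum_eq_zero, zero_add, ← Real.norm_eq_abs]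
  · refine tsum_of_norm_bounded
      ((summable_pow_succ_mul_succ hs0 hs1).hasSum.mul_left
        (2 * (K + 1) * ((n + 1 : ℕ) * s ^ n))) fun i => ?_
    have h1 := abs_rounding_le hf hx (i + n)
    have h2 := abs_rounding_le hf hy (i + n)
    have h3 := abs_sub (f (i + n) x : ℝ) (f (i + n) y)
    rw [← mul_sub, Real.norm_eq_abs, abs_mul, abs_of_pos (pow_pos hs0 _)]
    have h4 : (((i + n : ℕ) : ℝ) + 1) ≤ (n + 1 : ℕ) * ((i : ℝ) + 1) := by
      push_cast
      nlinarith [mul_nonneg (Nat.cast_nonneg (α := ℝ) i) (Nat.cast_nonneg (α := ℝ) n)]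
    calc _ ≤ s ^ (i + n + 1) * (2 * (K + 1) * ((n + 1 : ℕ) * ((i : ℝ) + 1))) := by
          gcongr
          have h5 := mul_le_mul_of_nonneg_left h4 (by positivity : (0 : ℝ) ≤ 2 * (K + 1))
          linarith
      _ = _ := by rw [add_right_comm i n 1, pow_add]; ring
  · intro j hj
    rw [hxy j (Finset.mem_range.1 hj), sub_self]

/-- The level of `x` determines the first `n` rounded multiples of `x`, by monotonicity. -/
theorem rounding_eq_of_sum_eq (hmono : ∀ j, Monotone (f j)) {n : ℕ} {x y : ℝ}
    (h : ∑ j ∈ Finset.range n, f j x = ∑ j ∈ Finset.range n, f j y) :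
    ∀ j < n, f j x = f j y := by
  wlog hxy : x ≤ y generalizing x y
  · exact fun j hj => (this h.symm (le_of_not_ge hxy) j hj).symm
  intro j hj
  exact (Finset.sum_eq_sum_iff_of_le fun i _ => hmono i hxy).1 h j (Finset.mem_range.2 hj)

theorem dimH_closure_image_rounding (hs0 : 0 < s) (hs1 : s < 1)
    (hf : ∀ j x, |(f j x : ℝ) - ((j : ℝ) + 1) * x| ≤ 1) (hmono : ∀ j, Monotone (f j))
    (a : ℝ) {b : ℝ} (hb : 0 ≤ b) (K : ℕ) :
    dimH (closure ((fun x => a + b * ∑' j, s ^ (j + 1) * (f j x : ℝ)) '' {x | |x| ≤ K})) = 0 := by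
  set G : ℝ → ℝ := fun x => a + b * ∑' j, s ^ (j + 1) * (f j x : ℝ) with hG
  have hW : 0 ≤ ∑' j : ℕ, s ^ (j + 1) * ((j : ℝ) + 1) := tsum_nonneg fun j => by positivity
  refine dimH_eq_zero_of_polynomial_cover hs0 hs1
    (A := b * (2 * (K + 1) * ∑' j : ℕ, s ^ (j + 1) * ((j : ℝ) + 1))) (by positivity) (K + 1)
    (fun n m => closure (G '' {x | |x| ≤ K ∧ ∑ j ∈ Finset.range n, f j x = m})) ?_ ?_
  · intro n m
    rw [Metric.ediam_closure]
    refine Metric.ediam_le_of_forall_dist_le ?_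
    rintro _ ⟨x, ⟨hx, hxm⟩, rfl⟩ _ ⟨y, ⟨hy, hym⟩, rfl⟩
    have h := abs_tsum_rounding_sub_le hs0 hs1 hf hx hy n
      (rounding_eq_of_sum_eq hmono (hxm.trans hym.symm))
    rw [hG, Real.dist_eq, add_sub_add_left_eq_sub, ← mul_sub, abs_mul, abs_of_nonneg hb]
    calc _ ≤ b * _ := mul_le_mul_of_nonneg_left h hb
      _ = _ := by ring
  · intro n
    rw [← closure_iUnion_of_finite]
    refine closure_mono ?_
    rintro _ ⟨x, hx, rfl⟩
    have hsum : |∑ j ∈ Finset.range n, f j x| ≤ ((K + 1 : ℕ) : ℤ) * n ^ 2 := by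
      refine (Finset.abs_sum_le_sum_abs _ _).trans ?_
      have h : ∀ j ∈ Finset.range n, |f j x| ≤ ((K + 1 : ℕ) : ℤ) * n := by
        intro j hj
        have h1 : |f j x| ≤ ((K : ℤ) + 1) * ((j : ℤ) + 1) := by
          exact_mod_cast abs_rounding_le hf hx j
        have h2 : ((j : ℤ) + 1) ≤ n := by exact_mod_cast Finset.mem_range.1 hj
        push_cast
        exact h1.trans (by gcongr)
      refine (Finset.sum_le_card_nsmul _ _ _ h).trans (le_of_eq ?_)
      rw [Finset.card_range, nsmul_eq_mul]
      ring
    exact Set.mem_iUnion.2 ⟨⟨_, Finset.mem_Icc.2 (abs_le.1 hsum)⟩, x, ⟨hx, rfl⟩, rfl⟩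

theorem dimH_closure_range_rounding (hs0 : 0 < s) (hs1 : s < 1)
    (hf : ∀ j x, |(f j x : ℝ) - ((j : ℝ) + 1) * x| ≤ 1) (hmono : ∀ j, Monotone (f j))
    (a : ℝ) {b : ℝ} (hb : 0 < b) :
    dimH (closure (Set.range fun x => a + b * ∑' j, s ^ (j + 1) * (f j x : ℝ))) = 0 := by
  set G : ℝ → ℝ := fun x => a + b * ∑' j, s ^ (j + 1) * (f j x : ℝ) with hG
  have hWs := summable_pow_succ_mul_succ hs0 hs1
  set W := ∑' j : ℕ, s ^ (j + 1) * ((j : ℝ) + 1) with hW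
  have hW0 : 0 < W := hWs.tsum_pos (fun j => by positivity) 0 (by positivity)
  have hgeom : Summable fun j : ℕ => s ^ (j + 1) :=
    (summable_nat_add_iff 1).2 (summable_geometric_of_lt_one hs0.le hs1)
  have hclose : ∀ x, |(∑' j, s ^ (j + 1) * (f j x : ℝ)) - W * x| ≤ ∑' j : ℕ, s ^ (j + 1) := by
    intro x
    rw [hW, ← tsum_mul_right, ← (summable_rounding hs0 hs1 hf x).tsum_sub (hWs.mul_right x),
      ← Real.norm_eq_abs]
    refine tsum_of_norm_bounded hgeom.hasSum fun j => ?_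
    rw [mul_assoc, ← mul_sub, Real.norm_eq_abs, abs_mul, abs_of_pos (pow_pos hs0 _)]
    exact mul_le_of_le_one_right (by positivity) (hf j x)
  have hcover : closure (Set.range G) ⊆ ⋃ K : ℕ, closure (G '' {x | |x| ≤ K}) := by
    intro y hy
    set E := ∑' j : ℕ, s ^ (j + 1)
    obtain ⟨K, hK⟩ := exists_nat_ge (((|y| + 1 + |a|) / b + E) / W)
    have hmem := Metric.isOpen_ball.inter_closure ⟨Metric.mem_ball_self one_pos, hy⟩
    refine Set.mem_iUnion.2 ⟨K, closure_mono ?_ hmem⟩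
    rintro _ ⟨hball, x, rfl⟩
    refine ⟨x, le_trans ?_ hK, rfl⟩
    rw [Metric.mem_ball, Real.dist_eq] at hball
    have h1 : b * |∑' j, s ^ (j + 1) * (f j x : ℝ)| ≤ |y| + 1 + |a| := by
      have h2 := abs_add_three (G x - y) y (-a)
      rw [abs_neg] at h2
      have h3 : G x - y + y + -a = b * ∑' j, s ^ (j + 1) * (f j x : ℝ) := by rw [hG]; ring
      rw [h3, abs_mul, abs_of_pos hb] at h2
      linarith
    rw [le_div_iff₀ hW0]
    have h4 := (le_div_iff₀' hb).2 h1
    have h5 := abs_sub_abs_le_abs_sub (W * x) (∑' j, s ^ (j + 1) * (f j x : ℝ))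
    rw [abs_sub_comm, abs_mul, abs_of_pos hW0] at h5
    linarith [hclose x]
  refine le_antisymm ((dimH_mono hcover).trans ?_) zero_le
  rw [dimH_iUnion]
  exact iSup_le fun K => (dimH_closure_image_rounding hs0 hs1 hf hmono a hb.le K).le

end RoundedMultiples

theorem stmt_16 (s : ℝ) (hs0 : 0 < s) (hs1 : s < 1) :
    dimH (closure (Set.range (DeltaMinus s) ∪ Set.range (DeltaPlus s))) = 0 := by
  have hb : 0 < ((1 - s) / s) ^ 2 := pow_pos (div_pos (sub_pos.2 hs1) hs0) 2
  have hminus := dimH_closure_range_rounding (f := fun j x => ⌈((j : ℝ) + 1) * x⌉) hs0 hs1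
    (fun j x => abs_le.2 ⟨by linarith [Int.le_ceil (((j : ℝ) + 1) * x)],
      by linarith [Int.ceil_lt_add_one (((j : ℝ) + 1) * x)]⟩)
    (fun j x y hxy => Int.ceil_mono (by gcongr)) 0 hb
  have hplus := dimH_closure_range_rounding (f := fun j x => ⌊((j : ℝ) + 1) * x⌋) hs0 hs1
    (fun j x => abs_le.2 ⟨by linarith [Int.lt_floor_add_one (((j : ℝ) + 1) * x)],
      by linarith [Int.floor_le (((j : ℝ) + 1) * x)]⟩)
    (fun j x y hxy => Int.floor_mono (by gcongr)) ((1 - s) / s) hb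
  simp only [zero_add] at hminus
  rw [closure_union, dimH_union]
  exact le_antisymm (max_le hminus.le hplus.le) zero_le
end

section
/- For every s with 0 < s < 1 and every ξ > 0, the set C_{s,ξ} (the closure in ℝ of the image of Υ_{s,ξ}⁺) has Hausdorff dimension 0. -/
open scoped BigOperators

open Filter Topology MeasureTheory Set

theorem dimH_closure_eq_zero_of_forall_exists_cover {X : Type*} [EMetricSpace X] {A : Set X}
    {r : ℝ} (hr0 : 0 < r) (hr1 : r < 1)
    (h : ∀ N : ℕ, ∃ t : Fin (N + 1) → Set X,
      A ⊆ ⋃ i, t i ∧ ∀ i, Metric.ediam (t i) ≤ ENNReal.ofReal (r ^ N)) :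
    dimH (closure A) = 0 := by
  borelize X
  choose t hA ht using h
  have hbound : ∀ d : NNReal, 0 < d → dimH (closure A) ≤ d := by
    intro d hd
    apply dimH_le_of_hausdorffMeasure_ne_top
    have hrd : r ^ (d : ℝ) < 1 := Real.rpow_lt_one hr0.le hr1 (by exact_mod_cast hd)
    have hrd0 : 0 < r ^ (d : ℝ) := Real.rpow_pos_of_pos hr0 _
    have hle := Measure.hausdorffMeasure_le_liminf_sum (l := atTop) (d : ℝ) (closure A)
      (fun N : ℕ => ENNReal.ofReal (r ^ N))
      (by simpa using ENNReal.tendsto_ofReal (tendsto_pow_atTop_nhds_zero_of_lt_one hr0.le hr1))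
      (fun N i => closure (t N i))
      (Eventually.of_forall fun N i => by rw [Metric.ediam_closure]; exact ht N i)
      (Eventually.of_forall fun N => by
        rw [← closure_iUnion_of_finite]; exact closure_mono (hA N))
    have hlim : Tendsto (fun N : ℕ => ENNReal.ofReal (((N : ℝ) + 1) * (r ^ (d : ℝ)) ^ N))
        atTop (𝓝 0) := by
      have h1 := (tendsto_self_mul_const_pow_of_lt_one hrd0.le hrd).add
        (tendsto_pow_atTop_nhds_zero_of_lt_one hrd0.le hrd)
      have h2 := ENNReal.tendsto_ofReal h1
      simpa [add_mul] using h2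
    have hzero : Measure.hausdorffMeasure (d : ℝ) (closure A) ≤ 0 := by
      refine hle.trans ?_
      rw [← hlim.liminf_eq]
      refine liminf_le_liminf (Eventually.of_forall fun N => ?_)
      calc ∑ i, Metric.ediam (closure (t N i)) ^ (d : ℝ)
          ≤ ∑ _i : Fin (N + 1), ENNReal.ofReal ((r ^ (d : ℝ)) ^ N) := by
            refine Finset.sum_le_sum fun i _ => ?_
            rw [Metric.ediam_closure, Real.rpow_pow_comm hr0.le,
              ← ENNReal.ofReal_rpow_of_nonneg (by positivity) (by positivity)]
            gcongr
            exact ht N i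
        _ = ENNReal.ofReal (((N : ℝ) + 1) * (r ^ (d : ℝ)) ^ N) := by
            rw [ENNReal.ofReal_mul (by positivity)]
            simp [ENNReal.ofReal_add]
    exact ne_top_of_le_ne_top ENNReal.zero_ne_top hzero
  refine le_antisymm (ENNReal.le_of_forall_pos_le_add fun ε hε _ => ?_) zero_le
  simpa using hbound ε hε

theorem abs_floor_sub_fract_sub_le (x a : ℝ) :
    |((⌊x - Int.fract a⌋ : ℤ) : ℝ) - x| ≤ 2 := by
  have h1 := Int.floor_le (x - Int.fract a)
  have h2 := Int.lt_floor_add_one (x - Int.fract a)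
  have h3 := Int.fract_nonneg a
  have h4 := Int.fract_lt_one a
  rw [abs_le]; constructor <;> linarith

theorem floor_sub_fract_of_floor_eq {n : ℤ} {x : ℝ} (hx : ⌊x⌋ = n) (a : ℝ) :
    ⌊x - Int.fract a⌋ = if Int.fract a ≤ Int.fract x then n else n - 1 := by
  have h := Int.self_sub_floor x
  rw [hx] at h
  have h1 := Int.fract_nonneg a
  have h2 := Int.fract_lt_one a
  have h3 := Int.fract_nonneg x
  have h4 := Int.fract_lt_one x
  split_ifs with hc
  · rw [Int.floor_eq_iff]; constructor <;> linarith
  · rw [Int.floor_eq_iff]; push_cast; constructor <;> linarith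

theorem tsum_pow_succ {s : ℝ} (hs0 : 0 < s) (hs1 : s < 1) :
    ∑' j : ℕ, s ^ (j + 1) = s / (1 - s) := by
  simp_rw [pow_succ']
  rw [tsum_mul_left, tsum_geometric_of_lt_one hs0.le hs1, div_eq_mul_inv]

theorem summable_pow_succ {s : ℝ} (hs0 : 0 < s) (hs1 : s < 1) :
    Summable fun j : ℕ => s ^ (j + 1) :=
  (summable_nat_add_iff 1).2 (summable_geometric_of_lt_one hs0.le hs1)

theorem summable_UpsilonPlus {s : ℝ} (hs0 : 0 < s) (hs1 : s < 1) (ξ x : ℝ) :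
    Summable fun j : ℕ =>
      s ^ (j + 1) * ((⌊x - Int.fract (((j : ℝ) + 1) * ξ)⌋ : ℤ) : ℝ) := by
  refine Summable.of_norm_bounded ((summable_pow_succ hs0 hs1).mul_right (|x| + 2)) fun j => ?_
  rw [norm_mul, Real.norm_of_nonneg (by positivity), Real.norm_eq_abs]
  gcongr
  have h := abs_le.1 (abs_floor_sub_fract_sub_le x (((j : ℝ) + 1) * ξ))
  have h1 := neg_abs_le x
  have h2 := le_abs_self x
  rw [abs_le]; constructor <;> linarith

theorem abs_UpsilonPlus_sub_le {s : ℝ} (hs0 : 0 < s) (hs1 : s < 1) (ξ x : ℝ) :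
    |UpsilonPlus s ξ x - (1 + x)| ≤ 2 := by
  have h1s : 0 < 1 - s := sub_pos.2 hs1
  have hsum := summable_UpsilonPlus hs0 hs1 ξ x
  have hx := (summable_pow_succ hs0 hs1).mul_right x
  have heq : UpsilonPlus s ξ x - (1 + x) = (1 - s) / s * ∑' j : ℕ,
      (s ^ (j + 1) * ((⌊x - Int.fract (((j : ℝ) + 1) * ξ)⌋ : ℤ) : ℝ) - s ^ (j + 1) * x) := by
    rw [hsum.tsum_sub hx, tsum_mul_right, tsum_pow_succ hs0 hs1, UpsilonPlus, mul_sub,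
      ← mul_assoc, div_mul_div_cancel₀ hs0.ne', div_self h1s.ne']
    ring
  have hb : ‖∑' j : ℕ,
      (s ^ (j + 1) * ((⌊x - Int.fract (((j : ℝ) + 1) * ξ)⌋ : ℤ) : ℝ) - s ^ (j + 1) * x)‖
      ≤ s / (1 - s) * 2 := by
    refine tsum_of_norm_bounded (g := fun j : ℕ => s ^ (j + 1) * 2) ?_ fun j => ?_
    · rw [← tsum_pow_succ hs0 hs1]
      exact (summable_pow_succ hs0 hs1).hasSum.mul_right 2
    · rw [← mul_sub, norm_mul, Real.norm_of_nonneg (by positivity), Real.norm_eq_abs]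
      gcongr
      exact abs_floor_sub_fract_sub_le _ _
  rw [heq, abs_mul, abs_of_pos (by positivity)]
  calc (1 - s) / s * |_| ≤ (1 - s) / s * (s / (1 - s) * 2) := by gcongr; exact hb
    _ = 2 := by field_simp

theorem abs_UpsilonPlus_sub_le_pow {s : ℝ} (hs0 : 0 < s) (hs1 : s < 1) (ξ : ℝ) {x y : ℝ}
    (hxy : ⌊x⌋ = ⌊y⌋) (N : ℕ)
    (h : ∀ j < N, (Int.fract (((j : ℝ) + 1) * ξ) ≤ Int.fract x ↔
      Int.fract (((j : ℝ) + 1) * ξ) ≤ Int.fract y)) :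
    |UpsilonPlus s ξ x - UpsilonPlus s ξ y| ≤ s ^ N := by
  have h1s : 0 < 1 - s := sub_pos.2 hs1
  have hx := summable_UpsilonPlus hs0 hs1 ξ x
  have hy := summable_UpsilonPlus hs0 hs1 ξ y
  have heq : UpsilonPlus s ξ x - UpsilonPlus s ξ y = (1 - s) / s * ∑' j : ℕ,
      (s ^ (j + 1) * ((⌊x - Int.fract (((j : ℝ) + 1) * ξ)⌋ : ℤ) : ℝ) -
        s ^ (j + 1) * ((⌊y - Int.fract (((j : ℝ) + 1) * ξ)⌋ : ℤ) : ℝ)) := by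
    rw [hx.tsum_sub hy, UpsilonPlus, UpsilonPlus]
    ring
  have hb : ‖∑' j : ℕ,
      (s ^ (j + 1) * ((⌊x - Int.fract (((j : ℝ) + 1) * ξ)⌋ : ℤ) : ℝ) -
        s ^ (j + 1) * ((⌊y - Int.fract (((j : ℝ) + 1) * ξ)⌋ : ℤ) : ℝ))‖
      ≤ s ^ N * (s / (1 - s)) := by
    rw [← (hx.sub hy).sum_add_tsum_nat_add N, Finset.sum_eq_zero, zero_add]
    · refine tsum_of_norm_bounded (g := fun j : ℕ => s ^ N * s ^ (j + 1)) ?_ fun j => ?_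
      · rw [← tsum_pow_succ hs0 hs1]
        exact (summable_pow_succ hs0 hs1).hasSum.mul_left _
      · rw [← mul_sub, norm_mul, Real.norm_of_nonneg (by positivity), ← pow_add,
          show j + N + 1 = N + (j + 1) by ring]
        refine mul_le_of_le_one_right (by positivity) ?_
        rw [floor_sub_fract_of_floor_eq hxy, floor_sub_fract_of_floor_eq rfl]
        split_ifs <;> simp
    · intro j hj
      rw [floor_sub_fract_of_floor_eq hxy, floor_sub_fract_of_floor_eq rfl,
        if_congr (h j (Finset.mem_range.1 hj)) rfl rfl, sub_self]
  rw [heq, abs_mul, abs_of_pos (by positivity)]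
  calc (1 - s) / s * |_| ≤ (1 - s) / s * (s ^ N * (s / (1 - s))) := by gcongr; exact hb
    _ = s ^ N := by field_simp

theorem dimH_closure_image_UpsilonPlus_floor_fiber {s : ℝ} (hs0 : 0 < s) (hs1 : s < 1) (ξ : ℝ)
    (n : ℤ) : dimH (closure (UpsilonPlus s ξ '' {x | ⌊x⌋ = n})) = 0 := by
  refine dimH_closure_eq_zero_of_forall_exists_cover hs0 hs1 fun N => ?_
  let below : ℝ → Finset ℕ := fun x =>
    {j ∈ Finset.range N | Int.fract (((j : ℝ) + 1) * ξ) ≤ Int.fract x}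
  have below_mono : ∀ x y, Int.fract x ≤ Int.fract y → below x ⊆ below y := fun x y hxy j hj => by
    simp only [below, Finset.mem_filter] at hj ⊢
    exact ⟨hj.1, hj.2.trans hxy⟩
  have below_eq : ∀ x y, (below x).card = (below y).card → below x = below y := by
    intro x y hc
    rcases le_total (Int.fract x) (Int.fract y) with hle | hle
    · exact Finset.eq_of_subset_of_card_le (below_mono x y hle) hc.ge
    · exact (Finset.eq_of_subset_of_card_le (below_mono y x hle) hc.le).symm
  refine ⟨fun k => UpsilonPlus s ξ '' {x | ⌊x⌋ = n ∧ (below x).card = k}, ?_, fun k => ?_⟩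
  · rintro _ ⟨x, hx, rfl⟩
    have hlt : (below x).card < N + 1 :=
      Nat.lt_succ_of_le ((Finset.card_filter_le _ _).trans_eq (Finset.card_range N))
    exact mem_iUnion.2 ⟨⟨_, hlt⟩, x, ⟨hx, rfl⟩, rfl⟩
  · refine Metric.ediam_le_of_forall_dist_le ?_
    rintro _ ⟨x, ⟨hx, hxk⟩, rfl⟩ _ ⟨y, ⟨hy, hyk⟩, rfl⟩
    refine abs_UpsilonPlus_sub_le_pow hs0 hs1 ξ (hx.trans hy.symm) N fun j hj => ?_
    have := Finset.ext_iff.1 (below_eq x y (hxk.trans hyk.symm)) j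
    simpa [below, hj] using this

theorem closure_range_UpsilonPlus_subset {s : ℝ} (hs0 : 0 < s) (hs1 : s < 1) (ξ : ℝ) :
    closure (range (UpsilonPlus s ξ)) ⊆
      ⋃ n : ℤ, closure (UpsilonPlus s ξ '' {x | ⌊x⌋ = n}) := by
  intro y hy
  have hy' := mem_closure_iff_nhds.1 hy
  have hmem : y ∈ closure (⋃ n ∈ Finset.Icc (⌊y⌋ - 5) (⌊y⌋ + 5),
      UpsilonPlus s ξ '' {x | ⌊x⌋ = n}) := by
    refine mem_closure_iff_nhds.2 fun U hU => ?_
    obtain ⟨_, ⟨hzU, hz⟩, x, rfl⟩ :=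
      hy' _ (inter_mem hU (Ioo_mem_nhds (sub_one_lt y) (lt_add_one y)))
    refine ⟨_, hzU, mem_iUnion₂.2 ⟨⌊x⌋, ?_, x, rfl, rfl⟩⟩
    have h := abs_le.1 (abs_UpsilonPlus_sub_le hs0 hs1 ξ x)
    have h1 := Int.floor_le y
    have h2 := Int.lt_floor_add_one y
    rw [Finset.mem_Icc, Int.le_floor, ← Int.lt_add_one_iff, Int.floor_lt]
    push_cast
    constructor <;> linarith [hz.1, hz.2]
  rw [Finset.closure_biUnion] at hmem
  obtain ⟨n, -, hn⟩ := mem_iUnion₂.1 hmem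
  exact mem_iUnion.2 ⟨n, hn⟩

theorem stmt_17 (s ξ : ℝ) (hs0 : 0 < s) (hs1 : s < 1) (hξ : 0 < ξ) :
    dimH (closure (Set.range (UpsilonPlus s ξ))) = 0 := by
  refine le_antisymm ((dimH_mono (closure_range_UpsilonPlus_subset hs0 hs1 ξ)).trans ?_) zero_le
  rw [dimH_iUnion]
  exact iSup_le fun n => (dimH_closure_image_UpsilonPlus_floor_fiber hs0 hs1 ξ n).le
end

section
/- Let 0 < s < 1 and ξ > 0. Then for every x with 0 ≤ x < 1, Υ_{s,ξ}⁺(x + ξ) = s·(Υ_{s,ξ}⁺(x) + Δ_s⁺(ξ)). -/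
open scoped BigOperators

/-- A geometric series weighted by the floors of an arithmetic progression converges. -/
theorem summable_geometric_mul_floor {s : ℝ} (hs0 : 0 < s) (hs1 : s < 1) (a b : ℝ) :
    Summable fun j : ℕ => s ^ (j + 1) * ((⌊a + ((j : ℝ) + 1) * b⌋ : ℤ) : ℝ) := by
  have h0 : Summable fun j : ℕ => s ^ j := summable_geometric_of_lt_one hs0.le hs1
  have h1 : Summable fun j : ℕ => (j : ℝ) ^ 1 * s ^ j :=
    summable_pow_mul_geometric_of_norm_lt_one 1 (by rwa [Real.norm_of_nonneg hs0.le])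
  have hg : Summable fun j : ℕ => s * (|a| + 1 + |b|) * s ^ j + s * |b| * ((j : ℝ) ^ 1 * s ^ j) :=
    (h0.mul_left _).add (h1.mul_left _)
  refine hg.of_norm_bounded fun j => ?_
  have hj : (0 : ℝ) ≤ (j : ℝ) + 1 := by positivity
  have hfloor : |((⌊a + ((j : ℝ) + 1) * b⌋ : ℤ) : ℝ)| ≤ |a| + ((j : ℝ) + 1) * |b| + 1 := by
    have hle := Int.floor_le (a + ((j : ℝ) + 1) * b)
    have hlt := Int.lt_floor_add_one (a + ((j : ℝ) + 1) * b)
    have habs : |a + ((j : ℝ) + 1) * b| ≤ |a| + ((j : ℝ) + 1) * |b| := by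
      refine (abs_add_le _ _).trans_eq ?_
      rw [abs_mul, abs_of_nonneg hj]
    rw [abs_le] at habs ⊢
    constructor <;> linarith [habs.1, habs.2]
  rw [norm_mul, norm_pow, Real.norm_of_nonneg hs0.le, Real.norm_eq_abs]
  calc s ^ (j + 1) * |((⌊a + ((j : ℝ) + 1) * b⌋ : ℤ) : ℝ)|
      ≤ s ^ (j + 1) * (|a| + ((j : ℝ) + 1) * |b| + 1) := by gcongr
    _ = s * (|a| + 1 + |b|) * s ^ j + s * |b| * ((j : ℝ) ^ 1 * s ^ j) := by ring

theorem floor_sub_fract (x y : ℝ) : ⌊x - Int.fract y⌋ = ⌊x - y⌋ + ⌊y⌋ := by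
  rw [← Int.floor_add_intCast, Int.fract, sub_sub_eq_add_sub, sub_add_eq_add_sub]

/-- The series defining `UpsilonPlus`, split by means of `⌊x - {jξ}⌋ = ⌊x - jξ⌋ + ⌊jξ⌋`. -/
theorem upsilonPlus_eq {s : ℝ} (hs0 : 0 < s) (hs1 : s < 1) (ξ x : ℝ) :
    UpsilonPlus s ξ x = 1 + (1 - s) / s *
      ((∑' j : ℕ, s ^ (j + 1) * ((⌊x - ((j : ℝ) + 1) * ξ⌋ : ℤ) : ℝ)) +
        ∑' j : ℕ, s ^ (j + 1) * ((⌊((j : ℝ) + 1) * ξ⌋ : ℤ) : ℝ)) := by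
  have hx : Summable fun j : ℕ => s ^ (j + 1) * ((⌊x - ((j : ℝ) + 1) * ξ⌋ : ℤ) : ℝ) := by
    simpa [sub_eq_add_neg] using summable_geometric_mul_floor hs0 hs1 x (-ξ)
  have h0 : Summable fun j : ℕ => s ^ (j + 1) * ((⌊((j : ℝ) + 1) * ξ⌋ : ℤ) : ℝ) := by
    simpa using summable_geometric_mul_floor hs0 hs1 0 ξ
  rw [← hx.tsum_add h0, UpsilonPlus]
  simp only [floor_sub_fract, Int.cast_add, mul_add]

theorem stmt_18 (s ξ : ℝ) (hs0 : 0 < s) (hs1 : s < 1) (hξ : 0 < ξ)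
    (x : ℝ) (hx0 : 0 ≤ x) (hx1 : x < 1) :
    UpsilonPlus s ξ (x + ξ) = s * (UpsilonPlus s ξ x + DeltaPlus s ξ) := by
  have hshift : (∑' j : ℕ, s ^ (j + 1) * ((⌊x + ξ - ((j : ℝ) + 1) * ξ⌋ : ℤ) : ℝ)) =
      s * ∑' j : ℕ, s ^ (j + 1) * ((⌊x - ((j : ℝ) + 1) * ξ⌋ : ℤ) : ℝ) := by
    have hsum : Summable fun j : ℕ =>
        s ^ (j + 1) * ((⌊x + ξ - ((j : ℝ) + 1) * ξ⌋ : ℤ) : ℝ) := by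
      simpa [sub_eq_add_neg] using summable_geometric_mul_floor hs0 hs1 (x + ξ) (-ξ)
    have hfloor : ⌊x⌋ = 0 := Int.floor_eq_zero_iff.2 ⟨hx0, hx1⟩
    rw [hsum.tsum_eq_zero_add, ← tsum_mul_left]
    simp only [Nat.cast_zero, zero_add, one_mul, add_sub_cancel_right, hfloor, Int.cast_zero,
      mul_zero]
    refine tsum_congr fun j => ?_
    have harg : x + ξ - (((j + 1 : ℕ) : ℝ) + 1) * ξ = x - ((j : ℝ) + 1) * ξ := by
      push_cast
      ring
    rw [harg]
    ring
  rw [upsilonPlus_eq hs0 hs1, upsilonPlus_eq hs0 hs1, hshift, DeltaPlus]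
  generalize (∑' j : ℕ, s ^ (j + 1) * ((⌊x - ((j : ℝ) + 1) * ξ⌋ : ℤ) : ℝ)) = A
  generalize (∑' j : ℕ, s ^ (j + 1) * ((⌊((j : ℝ) + 1) * ξ⌋ : ℤ) : ℝ)) = F
  field_simp
  ring
end
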